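/- arXiv:1905.09631 — 2 statements merged into one kernel-verified Lean document; each statement's English description precedes it below -/
import Mathlib

section
/- Suppose (H₁H₂/(H₁+H₂))·(2|k|+d) < 1. Then for every T>0, every x∈ℝ^d and every p∈[1,∞), the family of random variables L_ε^{(k)}(T,x) converges in L^p(Ω) as ε↓0; i.e. there exists a random variable L^{(k)}(T,x)∈L^p(Ω) with E[|L_ε^{(k)}(T,x) − L^{(k)}(T,x)|^p] → 0 as ε↓0. -/
open MeasureTheory ProbabilityTheory Filter Topology

noncomputable section

/-- The Gaussian heat kernel on `ℝ^d` with variance parameter `ε`. -/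
def heatKernel (d : ℕ) (ε : ℝ) (x : Fin d → ℝ) : ℝ :=
  (2 * Real.pi * ε) ^ (-(d : ℝ) / 2) * Real.exp (-(∑ i, (x i) ^ 2) / (2 * ε))

/-- Partial derivative in the `i`-th coordinate direction. -/
def pderivCoord (d : ℕ) (i : Fin d) (f : (Fin d → ℝ) → ℝ) : (Fin d → ℝ) → ℝ :=
  fun x => fderiv ℝ f x (Pi.single i 1)

/-- Iterated partial derivative `∂^{|k|}/∂x₁^{k₁}⋯∂x_d^{k_d}`. -/
def multiPDeriv (d : ℕ) (k : Fin d → ℕ) (f : (Fin d → ℝ) → ℝ) : (Fin d → ℝ) → ℝ :=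
  (List.finRange d).foldr (fun i g => (pderivCoord d i)^[k i] g) f

/-- `p_ε^{(k)}`, the `k`-th partial derivative of the Gaussian heat kernel. -/
def heatKernelDeriv (d : ℕ) (k : Fin d → ℕ) (ε : ℝ) : (Fin d → ℝ) → ℝ :=
  multiPDeriv d k (heatKernel d ε)

/-- The approximate `k`-th derivative of the local time,
`L_ε^{(k)}(T,x) = ∫₀^T ∫₀^T p_ε^{(k)}(X_t − X̃_s − x) ds dt`. -/
def locTimeApprox (d : ℕ) {Ω : Type*} (X Xt : ℝ → Ω → Fin d → ℝ)
    (k : Fin d → ℕ) (ε T : ℝ) (x : Fin d → ℝ) (ω : Ω) : ℝ :=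
  ∫ t in Set.Icc (0 : ℝ) T, ∫ s in Set.Icc (0 : ℝ) T,
    heatKernelDeriv d k ε (fun i => X t ω i - Xt s ω i - x i)

open scoped ENNReal

/-- The step function whose value at `τ` is the sum of the weights of the points beyond `τ`. -/
def weightBeyond {ι E : Type*} [Fintype ι] [AddCommMonoid E] (p : ι → ℝ) (c : ι → E) (τ : ℝ) : E :=
  ∑ i, if τ < p i then c i else 0

/-- Moving an atom onto the neighbouring atom on the side where the step function is larger
does not increase the norm of the step function. -/
theorem exists_neighbour {ι E : Type*} [Fintype ι] [Nonempty ι] [NormedAddCommGroup E]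
    (p : ι → ℝ) (c : ι → E) (t : ℝ) (y : E) (hsum : ∑ i, c i + y = 0) :
    ∃ i, (∀ τ, ‖weightBeyond p c τ + (if τ < p i then y else 0)‖
          ≤ ‖weightBeyond p c τ + (if τ < t then y else 0)‖) ∧
      ∀ τ ∈ Set.Ico (min t (p i)) (max t (p i)),
        ‖y‖ ≤ 2 * ‖weightBeyond p c τ + (if τ < t then y else 0)‖ := by
  classical
  by_cases hy : y = 0
  · obtain ⟨i⟩ := ‹Nonempty ι›
    exact ⟨i, by simp [hy], by simp [hy]⟩
  by_cases ht : ∃ i, p i = t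
  · obtain ⟨i, rfl⟩ := ht
    exact ⟨i, fun τ => le_rfl, by simp⟩
  push Not at ht
  set a := weightBeyond p c t with ha
  rcases le_or_gt ‖a + y‖ ‖a‖ with hle | hlt
  · have hne : (Finset.univ.filter fun i => t < p i).Nonempty := by
      by_contra hempty
      rw [Finset.not_nonempty_iff_eq_empty, Finset.filter_eq_empty_iff] at hempty
      have ha0 : a = 0 := by
        rw [ha, weightBeyond]
        exact Finset.sum_eq_zero fun i hi => if_neg (hempty hi)
      rw [ha0, zero_add, norm_zero, norm_le_zero_iff] at hle
      exact hy hle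
    obtain ⟨i, hi, hmin⟩ := Finset.exists_min_image _ p hne
    simp only [Finset.mem_filter, Finset.mem_univ, true_and] at hi hmin
    have hconst : ∀ τ, t ≤ τ → τ < p i → weightBeyond p c τ = a := by
      intro τ h1 h2
      rw [ha, weightBeyond, weightBeyond]
      refine Finset.sum_congr rfl fun j _ => ?_
      congr 1
      exact propext ⟨fun h => h1.trans_lt h, fun h => h2.trans_le (hmin j h)⟩
    refine ⟨i, fun τ => ?_, fun τ hτ => ?_⟩
    · by_cases h1 : τ < t
      · simp [h1, h1.trans hi]
      · by_cases h2 : τ < p i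
        · simpa [h1, h2, hconst τ (not_lt.1 h1) h2] using hle
        · simp [h1, h2]
    · rw [min_eq_left hi.le, max_eq_right hi.le] at hτ
      rw [hconst τ hτ.1 hτ.2, if_neg (not_lt.2 hτ.1), add_zero]
      calc ‖y‖ = ‖(a + y) - a‖ := by simp
        _ ≤ ‖a + y‖ + ‖a‖ := norm_sub_le _ _
        _ ≤ 2 * ‖a‖ := by linarith
  · have hne : (Finset.univ.filter fun i => p i < t).Nonempty := by
      by_contra hempty
      rw [Finset.not_nonempty_iff_eq_empty, Finset.filter_eq_empty_iff] at hempty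
      have ha0 : a + y = 0 := by
        rw [← hsum, ha, weightBeyond]
        congr 1
        exact Finset.sum_congr rfl fun i hi =>
          if_pos (lt_of_le_of_ne (not_lt.1 (hempty hi)) (ht i).symm)
      rw [ha0, norm_zero] at hlt
      exact absurd hlt (not_lt.2 (norm_nonneg _))
    obtain ⟨i, hi, hmax⟩ := Finset.exists_max_image _ p hne
    simp only [Finset.mem_filter, Finset.mem_univ, true_and] at hi hmax
    have hconst : ∀ τ, p i ≤ τ → τ < t → weightBeyond p c τ = a := by
      intro τ h1 h2
      rw [ha, weightBeyond, weightBeyond]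
      refine Finset.sum_congr rfl fun j _ => ?_
      congr 1
      refine propext ⟨fun h => ?_, fun h => h2.trans h⟩
      by_contra hj
      exact absurd (hmax j (lt_of_le_of_ne (not_lt.1 hj) (ht j))) (not_le.2 (h1.trans_lt h))
    refine ⟨i, fun τ => ?_, fun τ hτ => ?_⟩
    · by_cases h1 : τ < p i
      · simp [h1, h1.trans hi]
      · by_cases h2 : τ < t
        · simpa [h1, h2, hconst τ (not_lt.1 h1) h2] using hlt.le
        · simp [h1, h2]
    · rw [min_eq_right hi.le, max_eq_left hi.le] at hτ
      rw [hconst τ hτ.1 hτ.2, if_pos hτ.2]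
      calc ‖y‖ = ‖(a + y) - a‖ := by simp
        _ ≤ ‖a + y‖ + ‖a‖ := norm_sub_le _ _
        _ ≤ 2 * ‖a + y‖ := by linarith

/-- The weights of `N` points after a further point of weight `y₀` has been moved onto one of
`M` anchors or onto one of the points. -/
def mergeAt {E : Type*} [AddCommMonoid E] {M N : ℕ} (y₀ : E) (y : Fin N → E) :
    Fin M ⊕ Fin N → Fin N → E :=
  Sum.elim (fun _ => y) fun l => y + Pi.single l y₀

/-- The profile `u ↦ (1 + u)⁻²`. -/
def decay (u : ℝ≥0∞) : ℝ≥0∞ := ((1 + u) ^ 2)⁻¹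

theorem decay_anti : Antitone decay := fun a b h => by
  unfold decay; gcongr

theorem decay_le_one (u : ℝ≥0∞) : decay u ≤ 1 := by
  unfold decay
  rw [ENNReal.inv_le_one]
  exact one_le_pow₀ (by simp)

theorem measurable_decay : Measurable decay := by
  unfold decay; fun_prop

/-- The kernel obtained by collapsing the points one after the other onto neighbouring points
or anchors. -/
def chainKernel {E : Type*} [SeminormedAddCommGroup E] {M : ℕ} (θ : ℝ) (r : Fin M → ℝ) :
    (N : ℕ) → (Fin N → E) → (Fin N → ℝ) → ℝ≥0∞
  | 0, _, _ => 1
  | N + 1, y, t => ∑ o : Fin M ⊕ Fin N,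
      decay ((‖y 0‖ₑ / 2) ^ θ * ‖t 0 - Sum.elim r (Fin.tail t) o‖ₑ)
        * chainKernel θ r N (mergeAt (y 0) (Fin.tail y) o) (Fin.tail t)

/-- The integrated form of `chainKernel`. -/
def chainWeight {E : Type*} [SeminormedAddCommGroup E] (M : ℕ) (θ : ℝ) :
    (N : ℕ) → (Fin N → E) → ℝ≥0∞
  | 0, _ => 1
  | N + 1, y => (1 + ‖y 0‖ₑ) ^ (-θ) * ∑ o : Fin M ⊕ Fin N,
      chainWeight M θ N (mergeAt (y 0) (Fin.tail y) o)

theorem decay_pow_le_chainKernel {E : Type*} [NormedAddCommGroup E] {M : ℕ} [NeZero M]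
    {θ : ℝ} (hθ : 0 ≤ θ) (r : Fin M → ℝ) (N : ℕ) :
    ∀ (c : Fin M → E) (y : Fin N → E) (t : Fin N → ℝ), ∑ m, c m + ∑ j, y j = 0 →
      decay (∫⁻ τ, ‖weightBeyond (Sum.elim r t) (Sum.elim c y) τ‖ₑ ^ θ) ^ N
        ≤ chainKernel θ r N y t := by
  induction N with
  | zero => intro c y t _; simp [chainKernel]
  | succ N ih =>
    intro c y t hsum
    rw [Fin.sum_univ_succ] at hsum
    obtain ⟨o, ho₁, ho₂⟩ := exists_neighbour (Sum.elim r (Fin.tail t))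
      (Sum.elim c (Fin.tail y)) (t 0) (y 0) (by
        rw [Fintype.sum_sum_type]
        simp only [Sum.elim_inl, Sum.elim_inr, Fin.tail]
        rw [← hsum]; abel)
    have hsplit : ∀ τ, weightBeyond (Sum.elim r t) (Sum.elim c y) τ
        = weightBeyond (Sum.elim r (Fin.tail t)) (Sum.elim c (Fin.tail y)) τ
          + if τ < t 0 then y 0 else 0 := by
      intro τ
      simp only [weightBeyond, Fintype.sum_sum_type, Sum.elim_inl, Sum.elim_inr,
        Fin.sum_univ_succ]
      rw [add_assoc]
      exact congrArg _ (add_comm _ _)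
    set c' : Fin M → E := Sum.elim (fun m => c + Pi.single m (y 0)) (fun _ => c) o with hc'
    set y' : Fin N → E := mergeAt (y 0) (Fin.tail y) o with hy'
    have hmoved : ∀ τ, weightBeyond (Sum.elim r (Fin.tail t)) (Sum.elim c' y') τ
        = weightBeyond (Sum.elim r (Fin.tail t)) (Sum.elim c (Fin.tail y)) τ
          + if τ < Sum.elim r (Fin.tail t) o then y 0 else 0 := by
      intro τ
      have aux : ∀ {n : ℕ} (p : Fin n → ℝ) (b : Fin n → E) (l : Fin n),
          (∑ i, if τ < p i then (b + Pi.single l (y 0) : Fin n → E) i else 0)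
            = (∑ i, if τ < p i then b i else 0) + if τ < p l then y 0 else 0 := by
        intro n p b l
        have : ∀ i, (if τ < p i then (b + Pi.single l (y 0) : Fin n → E) i else 0)
            = (if τ < p i then b i else 0)
              + if i = l then (if τ < p l then y 0 else 0) else 0 := by
          intro i
          by_cases h : i = l
          · subst h; by_cases h2 : τ < p i <;> simp [h2]
          · by_cases h2 : τ < p i <;> simp [h, h2]
        simp only [this, Finset.sum_add_distrib, Finset.sum_ite_eq', Finset.mem_univ, if_true]
      rcases o with m | l
      · simp only [hc', hy', mergeAt, weightBeyond, Fintype.sum_sum_type, Sum.elim_inl,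
          Sum.elim_inr]
        exact (congrArg₂ (· + ·) (aux r c m) rfl).trans (add_right_comm _ _ _)
      · simp only [hc', hy', mergeAt, weightBeyond, Fintype.sum_sum_type, Sum.elim_inl,
          Sum.elim_inr]
        exact (congrArg₂ (· + ·) rfl (aux (Fin.tail t) (Fin.tail y) l)).trans
          (add_assoc _ _ _).symm
    have hsum' : ∑ m, c' m + ∑ j, y' j = 0 := by
      rcases o with m | l
      · simp only [hc', hy', mergeAt, Sum.elim_inl, Pi.add_apply, Finset.sum_add_distrib,
          Finset.sum_pi_single', Finset.mem_univ, if_true]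
        rw [← hsum]; simp only [Fin.tail]; abel
      · simp only [hc', hy', mergeAt, Sum.elim_inr, Pi.add_apply, Finset.sum_add_distrib,
          Finset.sum_pi_single', Finset.mem_univ, if_true]
        rw [← hsum]; simp only [Fin.tail]; abel
    set I := ∫⁻ τ, ‖weightBeyond (Sum.elim r t) (Sum.elim c y) τ‖ₑ ^ θ with hI
    have hI₁ : ∫⁻ τ, ‖weightBeyond (Sum.elim r (Fin.tail t)) (Sum.elim c' y') τ‖ₑ ^ θ ≤ I := by
      refine lintegral_mono fun τ => ENNReal.rpow_le_rpow ?_ hθ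
      rw [hmoved, hsplit]
      exact enorm_le_iff_norm_le.2 (ho₁ τ)
    have hI₂ : (‖y 0‖ₑ / 2) ^ θ * ‖t 0 - Sum.elim r (Fin.tail t) o‖ₑ ≤ I := by
      set s := Sum.elim r (Fin.tail t) o
      have hvol : ‖t 0 - s‖ₑ = volume (Set.Ico (min (t 0) s) (max (t 0) s)) := by
        rw [Real.volume_Ico, max_sub_min_eq_abs, ← ofReal_norm, Real.norm_eq_abs,
          abs_sub_comm]
      rw [hvol, ← setLIntegral_const]
      refine (setLIntegral_mono_ae' measurableSet_Ico ?_).trans (setLIntegral_le_lintegral _ _)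
      refine ae_of_all _ fun τ hτ => ENNReal.rpow_le_rpow ?_ hθ
      refine ENNReal.div_le_of_le_mul' ?_
      rw [hsplit]
      have := ho₂ τ hτ
      rw [← ofReal_norm, ← ofReal_norm,
        show (2 : ℝ≥0∞) = ENNReal.ofReal 2 by simp, ← ENNReal.ofReal_mul (by norm_num)]
      exact ENNReal.ofReal_le_ofReal this
    calc decay I ^ (N + 1) = decay I * decay I ^ N := by rw [pow_succ']
      _ ≤ decay ((‖y 0‖ₑ / 2) ^ θ * ‖t 0 - Sum.elim r (Fin.tail t) o‖ₑ)
            * chainKernel θ r N y' (Fin.tail t) := by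
          refine mul_le_mul' (decay_anti hI₂) (le_trans ?_ (ih c' y' (Fin.tail t) hsum'))
          exact pow_le_pow_left' (decay_anti hI₁) N
      _ ≤ chainKernel θ r (N + 1) y t := by
          rw [chainKernel]
          exact Finset.single_le_sum (f := fun o => decay ((‖y 0‖ₑ / 2) ^ θ
            * ‖t 0 - Sum.elim r (Fin.tail t) o‖ₑ)
            * chainKernel θ r N (mergeAt (y 0) (Fin.tail y) o) (Fin.tail t))
            (fun _ _ => zero_le) (Finset.mem_univ o)

theorem lintegral_pi_fin_succ {α : Type*} [MeasurableSpace α] (μ : Measure α) [SigmaFinite μ]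
    {N : ℕ} {f : (Fin (N + 1) → α) → ℝ≥0∞} (hf : Measurable f) :
    ∫⁻ t, f t ∂(Measure.pi fun _ : Fin (N + 1) => μ)
      = ∫⁻ t', ∫⁻ s, f (Fin.cons s t') ∂μ ∂(Measure.pi fun _ : Fin N => μ) := by
  have hmp := (measurePreserving_piFinSuccAbove (fun _ : Fin (N + 1) => μ) 0).symm
  rw [← hmp.lintegral_comp hf]
  refine (lintegral_prod_symm' (μ := μ) (ν := Measure.pi fun _ : Fin N => μ)
    (fun z : α × (Fin N → α) =>
    f ((MeasurableEquiv.piFinSuccAbove (fun _ : Fin (N + 1) => α) 0).symm z))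
    (hf.comp (MeasurableEquiv.measurable _))).trans ?_
  refine lintegral_congr fun t' => lintegral_congr fun s => congrArg f ?_
  exact Fin.insertNth_zero' s t'

theorem measurable_chainKernel {E : Type*} [SeminormedAddCommGroup E] {M : ℕ} (θ : ℝ)
    (r : Fin M → ℝ) (N : ℕ) (y : Fin N → E) : Measurable (chainKernel θ r N y) := by
  induction N with
  | zero => exact measurable_const
  | succ N ih =>
    have : chainKernel θ r (N + 1) y = fun t => ∑ o : Fin M ⊕ Fin N,
      decay ((‖y 0‖ₑ / 2) ^ θ * ‖t 0 - Sum.elim r (Fin.tail t) o‖ₑ)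
        * chainKernel θ r N (mergeAt (y 0) (Fin.tail y) o) (Fin.tail t) := rfl
    rw [this]
    have htail : Measurable fun t : Fin (N + 1) → ℝ => Fin.tail t :=
      measurable_pi_lambda _ fun i => measurable_pi_apply _
    refine Finset.measurable_fun_sum _ fun o _ => ?_
    refine Measurable.mul (measurable_decay.comp (Measurable.const_mul ?_ _)) ((ih _).comp htail)
    refine Measurable.enorm ((measurable_pi_apply 0).sub ?_)
    rcases o with m | l
    · exact measurable_const
    · exact measurable_pi_apply _

theorem lintegral_mul_decay_ne_top : ∫⁻ τ : ℝ, decay ‖τ‖ₑ ≠ ⊤ := by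
  have h := (integrable_one_add_norm (E := ℝ) (μ := volume) (r := 2) (by simp)).lintegral_lt_top
  refine ne_of_lt (lt_of_eq_of_lt (lintegral_congr fun τ => ?_) h)
  have h1 : (0 : ℝ) < 1 + ‖τ‖ := by positivity
  rw [decay, ← ofReal_norm, ← ENNReal.ofReal_one, ← ENNReal.ofReal_add zero_le_one (norm_nonneg _),
    ← ENNReal.ofReal_pow h1.le, ← ENNReal.ofReal_inv_of_pos (by positivity),
    Real.rpow_neg h1.le, Real.rpow_two]

theorem lintegral_decay_mul {a : ℝ≥0∞} (ha : a ≠ ⊤) (s : ℝ) :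
    a * ∫⁻ τ : ℝ, decay (a * ‖τ - s‖ₑ) ≤ ∫⁻ τ : ℝ, decay ‖τ‖ₑ := by
  rcases eq_or_ne a 0 with rfl | h0
  · simp
  have hpos : 0 < a.toReal := ENNReal.toReal_pos h0 ha
  have hae : a = ‖a.toReal‖ₑ := by
    rw [← ofReal_norm, Real.norm_of_nonneg hpos.le, ENNReal.ofReal_toReal ha]
  rw [lintegral_sub_right_eq_self (fun τ => decay (a * ‖τ‖ₑ)) s]
  have hscale : ∫⁻ τ : ℝ, decay ‖τ‖ₑ
      = ∫⁻ τ, decay ‖τ‖ₑ ∂(ENNReal.ofReal |a.toReal| • Measure.map (a.toReal * ·) volume) := by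
    rw [Real.smul_map_volume_mul_left hpos.ne']
  have hmap : ∫⁻ τ, decay ‖τ‖ₑ ∂(Measure.map (a.toReal * ·) (volume : Measure ℝ))
      = ∫⁻ τ : ℝ, decay ‖a.toReal * τ‖ₑ :=
    lintegral_map (measurable_decay.comp measurable_enorm) (measurable_const_mul _)
  rw [hscale, lintegral_smul_measure, hmap, abs_of_pos hpos, ENNReal.ofReal_toReal ha, smul_eq_mul]
  simp_rw [enorm_mul, ← hae]
  exact le_rfl

theorem one_le_ennreal_rpow {x : ℝ≥0∞} (hx : 1 ≤ x) {z : ℝ} (hz : 0 ≤ z) : 1 ≤ x ^ z := by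
  simpa using ENNReal.rpow_le_rpow hx hz

theorem one_add_rpow_le {θ : ℝ} (hθ : 0 ≤ θ) (u : ℝ≥0∞) :
    (1 + u) ^ θ ≤ 4 ^ θ * (1 + (u / 2) ^ θ) := by
  have h4 : (1 : ℝ≥0∞) ≤ 4 ^ θ := one_le_ennreal_rpow (by norm_num) hθ
  rcases le_total u 1 with h | h
  · calc (1 + u) ^ θ ≤ 4 ^ θ := by
          refine ENNReal.rpow_le_rpow ?_ hθ
          calc 1 + u ≤ 1 + 1 := by gcongr
            _ ≤ 4 := by norm_num
      _ ≤ _ := le_mul_of_one_le_right' (by simp)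
  · calc (1 + u) ^ θ ≤ (4 * (u / 2)) ^ θ := by
          refine ENNReal.rpow_le_rpow ?_ hθ
          calc 1 + u ≤ u + u := by gcongr
            _ = 2 * u := (two_mul u).symm
            _ = 4 * (u / 2) := by
              rw [show (4 : ℝ≥0∞) = 2 * 2 by norm_num, mul_assoc,
                ENNReal.mul_div_cancel (by norm_num) (by norm_num)]
      _ = 4 ^ θ * (u / 2) ^ θ := ENNReal.mul_rpow_of_nonneg _ _ hθ
      _ ≤ _ := by gcongr; simp

theorem exists_setLIntegral_decay_le {E : Type*} [NormedAddCommGroup E] {θ : ℝ} (hθ : 0 ≤ θ)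
    (T : ℝ) : ∃ C : ℝ≥0∞, C ≠ ⊤ ∧ ∀ (w : E) (s : ℝ),
      ∫⁻ τ in Set.Icc 0 T, decay ((‖w‖ₑ / 2) ^ θ * ‖τ - s‖ₑ) ≤ C * (1 + ‖w‖ₑ) ^ (-θ) := by
  refine ⟨4 ^ θ * (ENNReal.ofReal T + ∫⁻ τ : ℝ, decay ‖τ‖ₑ), ?_, fun w s => ?_⟩
  · exact ENNReal.mul_ne_top (ENNReal.rpow_ne_top_of_nonneg hθ (by norm_num))
      (ENNReal.add_ne_top.2 ⟨ENNReal.ofReal_ne_top, lintegral_mul_decay_ne_top⟩)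
  set a := (‖w‖ₑ / 2) ^ θ with ha
  have hw : 1 + ‖w‖ₑ ≠ ⊤ := by simp
  have hatop : a ≠ ⊤ := ENNReal.rpow_ne_top_of_nonneg hθ (ENNReal.div_ne_top (by simp) (by simp))
  rw [ENNReal.rpow_neg, ← div_eq_mul_inv, ENNReal.le_div_iff_mul_le
    (Or.inl (ENNReal.rpow_pos (by simp) hw).ne') (Or.inl (ENNReal.rpow_ne_top_of_nonneg hθ hw))]
  have h1 : ∫⁻ τ in Set.Icc 0 T, decay (a * ‖τ - s‖ₑ) ≤ ENNReal.ofReal T := by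
    calc _ ≤ ∫⁻ τ in Set.Icc 0 T, 1 := lintegral_mono fun τ => decay_le_one _
      _ = ENNReal.ofReal T := by simp
  have h2 : a * ∫⁻ τ in Set.Icc 0 T, decay (a * ‖τ - s‖ₑ) ≤ ∫⁻ τ : ℝ, decay ‖τ‖ₑ :=
    le_trans (by gcongr; exact Measure.restrict_le_self) (lintegral_decay_mul hatop s)
  calc (∫⁻ τ in Set.Icc 0 T, decay (a * ‖τ - s‖ₑ)) * (1 + ‖w‖ₑ) ^ θ
      ≤ (∫⁻ τ in Set.Icc 0 T, decay (a * ‖τ - s‖ₑ)) * (4 ^ θ * (1 + a)) := by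
        gcongr; exact one_add_rpow_le hθ _
    _ = 4 ^ θ * ((∫⁻ τ in Set.Icc 0 T, decay (a * ‖τ - s‖ₑ))
          + a * ∫⁻ τ in Set.Icc 0 T, decay (a * ‖τ - s‖ₑ)) := by ring
    _ ≤ _ := by gcongr

theorem exists_lintegral_chainKernel_le {E : Type*} [NormedAddCommGroup E] (M : ℕ) {θ : ℝ}
    (hθ : 0 ≤ θ) (T : ℝ) (N : ℕ) : ∃ C : ℝ≥0∞, C ≠ ⊤ ∧ ∀ (r : Fin M → ℝ) (y : Fin N → E),
      ∫⁻ t, chainKernel θ r N y t ∂(Measure.pi fun _ => volume.restrict (Set.Icc 0 T))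
        ≤ C * chainWeight M θ N y := by
  obtain ⟨C₀, hC₀, hdecay⟩ := exists_setLIntegral_decay_le (E := E) hθ T
  induction N with
  | zero => exact ⟨1, by simp, fun r y => by simp [chainKernel, chainWeight]⟩
  | succ N ih =>
    obtain ⟨C, hC, hle⟩ := ih
    refine ⟨C₀ * C, ENNReal.mul_ne_top hC₀ hC, fun r y => ?_⟩
    rw [lintegral_pi_fin_succ _ (measurable_chainKernel θ r _ y)]
    set μ : Measure (Fin N → ℝ) := Measure.pi fun _ => volume.restrict (Set.Icc 0 T)
    calc ∫⁻ t', ∫⁻ s in Set.Icc 0 T, chainKernel θ r (N + 1) y (Fin.cons s t') ∂volume ∂μ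
        ≤ ∫⁻ t', ∑ o, (C₀ * (1 + ‖y 0‖ₑ) ^ (-θ))
            * chainKernel θ r N (mergeAt (y 0) (Fin.tail y) o) t' ∂μ := by
          refine lintegral_mono fun t' => ?_
          simp only [chainKernel, Fin.cons_zero, Fin.tail_cons]
          rw [lintegral_finsetSum']
          · refine Finset.sum_le_sum fun o _ => ?_
            rw [lintegral_mul_const]
            · gcongr
              exact hdecay _ _
            · exact measurable_decay.comp (Measurable.const_mul
                (Measurable.enorm (measurable_id.sub measurable_const)) _)
          · intro o _
            exact (Measurable.mul_const (measurable_decay.comp (Measurable.const_mul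
                (Measurable.enorm (measurable_id.sub measurable_const)) _)) _).aemeasurable
      _ = ∑ o, (C₀ * (1 + ‖y 0‖ₑ) ^ (-θ))
            * ∫⁻ t', chainKernel θ r N (mergeAt (y 0) (Fin.tail y) o) t' ∂μ := by
          rw [lintegral_finsetSum' _ fun o _ =>
            ((measurable_chainKernel θ r N _).const_mul _).aemeasurable]
          exact Finset.sum_congr rfl fun o _ => lintegral_const_mul _ (measurable_chainKernel θ r N _)
      _ ≤ ∑ o : Fin M ⊕ Fin N, (C₀ * (1 + ‖y 0‖ₑ) ^ (-θ))
            * (C * chainWeight M θ N (mergeAt (y 0) (Fin.tail y) o)) := by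
          gcongr; exact hle _ _
      _ = C₀ * C * chainWeight M θ (N + 1) y := by
          rw [chainWeight, Finset.mul_sum, Finset.mul_sum]
          exact Finset.sum_congr rfl fun o _ => by ring

theorem exists_chainWeight_rpow_le {E : Type*} [NormedAddCommGroup E] (M : ℕ) (θ : ℝ) {p : ℝ}
    (hp : 1 ≤ p) (N : ℕ) : ∃ C : ℝ≥0∞, C ≠ ⊤ ∧ ∀ y : Fin N → E,
      chainWeight M θ N y ^ p ≤ C * chainWeight M (θ * p) N y := by
  have hp0 : 0 ≤ p := zero_le_one.trans hp
  induction N with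
  | zero => exact ⟨1, by simp, fun y => by simp [chainWeight]⟩
  | succ N ih =>
    obtain ⟨C, hC, hle⟩ := ih
    refine ⟨(Fintype.card (Fin M ⊕ Fin N) : ℝ≥0∞) ^ (p - 1) * C, ENNReal.mul_ne_top
      (ENNReal.rpow_ne_top_of_nonneg (by linarith) (by simp)) hC, fun y => ?_⟩
    rw [chainWeight, ENNReal.mul_rpow_of_nonneg _ _ hp0, ← ENNReal.rpow_mul, neg_mul, chainWeight]
    calc _ ≤ (1 + ‖y 0‖ₑ) ^ (-(θ * p)) * ((Fintype.card (Fin M ⊕ Fin N) : ℝ≥0∞) ^ (p - 1)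
            * ∑ o : Fin M ⊕ Fin N, chainWeight M θ N (mergeAt (y 0) (Fin.tail y) o) ^ p) := by
          gcongr
          exact ENNReal.rpow_sum_le_const_mul_sum_rpow _ _ hp
      _ ≤ (1 + ‖y 0‖ₑ) ^ (-(θ * p)) * ((Fintype.card (Fin M ⊕ Fin N) : ℝ≥0∞) ^ (p - 1)
            * ∑ o : Fin M ⊕ Fin N,
              C * chainWeight M (θ * p) N (mergeAt (y 0) (Fin.tail y) o)) := by
          gcongr; exact hle _
      _ = _ := by rw [← Finset.mul_sum]; ring

theorem measurable_chainWeight (d M : ℕ) (θ : ℝ) (N : ℕ) :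
    Measurable (chainWeight M θ N : (Fin N → Fin d → ℝ) → ℝ≥0∞) := by
  induction N with
  | zero => exact measurable_const
  | succ N ih =>
    have : (chainWeight M θ (N + 1) : (Fin (N + 1) → Fin d → ℝ) → ℝ≥0∞) =
      fun y => (1 + ‖y 0‖ₑ) ^ (-θ) * ∑ o : Fin M ⊕ Fin N,
        chainWeight M θ N (mergeAt (y 0) (Fin.tail y) o) := rfl
    rw [this]
    have htail : Measurable fun y : Fin (N + 1) → Fin d → ℝ => Fin.tail y :=
      measurable_pi_lambda _ fun i => measurable_pi_apply _
    refine Measurable.mul (by fun_prop) (Finset.measurable_fun_sum _ fun o _ => ih.comp ?_)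
    rcases o with m | l
    · exact htail
    · refine htail.add (measurable_pi_lambda _ fun i => ?_)
      by_cases h : i = l
      · subst h; simpa using measurable_pi_apply _
      · simp [h]

theorem lintegral_one_add_enorm_rpow_lt_top (d : ℕ) {β : ℝ} (hβ : (d : ℝ) < β) :
    ∫⁻ y : Fin d → ℝ, (1 + ‖y‖ₑ) ^ (-β) < ⊤ := by
  have h := (integrable_one_add_norm (E := Fin d → ℝ) (μ := volume) (r := β)
    (by simpa using hβ)).lintegral_lt_top
  refine lt_of_eq_of_lt (lintegral_congr fun y => ?_) h
  have h1 : (0 : ℝ) < 1 + ‖y‖ := by positivity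
  rw [← ofReal_norm, ← ENNReal.ofReal_one, ← ENNReal.ofReal_add zero_le_one (norm_nonneg _),
    ENNReal.ofReal_rpow_of_pos h1]

theorem prod_one_add_enorm_rpow_le {E : Type*} [NormedAddCommGroup E] {M N : ℕ} {κ : ℝ}
    (hκ : 0 ≤ κ) (y₀ : E) (y : Fin N → E) (o : Fin M ⊕ Fin N) :
    ∏ j, (1 + ‖y j‖ₑ) ^ κ ≤ (1 + ‖y₀‖ₑ) ^ κ * ∏ j, (1 + ‖mergeAt y₀ y o j‖ₑ) ^ κ := by
  classical
  have h1 : 1 ≤ (1 + ‖y₀‖ₑ) ^ κ := one_le_ennreal_rpow (by simp) hκ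
  rcases o with m | l
  · exact le_mul_of_one_le_left' h1
  · rw [← Finset.mul_prod_erase _ _ (Finset.mem_univ l),
      ← Finset.mul_prod_erase _ (fun j => (1 + ‖mergeAt y₀ y (Sum.inr l : Fin M ⊕ Fin N) j‖ₑ) ^ κ)
        (Finset.mem_univ l), ← mul_assoc, ← ENNReal.mul_rpow_of_nonneg _ _ hκ]
    refine mul_le_mul' (ENNReal.rpow_le_rpow ?_ hκ) (le_of_eq ?_)
    · simp only [mergeAt, Sum.elim_inr, Pi.add_apply, Pi.single_eq_same]
      calc 1 + ‖y l‖ₑ = 1 + ‖(y l + y₀) - y₀‖ₑ := by simp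
        _ ≤ 1 + (‖y l + y₀‖ₑ + ‖y₀‖ₑ) := by gcongr; exact enorm_sub_le
        _ ≤ 1 + (‖y l + y₀‖ₑ + ‖y₀‖ₑ) + ‖y₀‖ₑ * ‖y l + y₀‖ₑ := le_self_add
        _ = (1 + ‖y₀‖ₑ) * (1 + ‖y l + y₀‖ₑ) := by ring
    · refine Finset.prod_congr rfl fun j hj => ?_
      simp [mergeAt, Finset.ne_of_mem_erase hj]

theorem lintegral_chainWeight_lt_top (d M : ℕ) {α κ : ℝ} (hκ : 0 ≤ κ) (hα : 2 * κ + d < α)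
    (N : ℕ) : ∫⁻ y : Fin N → Fin d → ℝ, (∏ j, (1 + ‖y j‖ₑ) ^ κ) * chainWeight M α N y < ⊤ := by
  induction N with
  | zero =>
    simp [chainWeight, volume_pi]
  | succ N ih =>
    have htail : Measurable fun y : Fin (N + 1) → Fin d → ℝ => Fin.tail y :=
      measurable_pi_lambda _ fun i => measurable_pi_apply _
    set w : (Fin N → Fin d → ℝ) → ℝ≥0∞ := fun y => (∏ j, (1 + ‖y j‖ₑ) ^ κ) * chainWeight M α N y
      with hw
    have hwm : Measurable w := by
      refine Measurable.mul ?_ (measurable_chainWeight d M α N)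
      fun_prop
    have hmerge : ∀ (y₀ : Fin d → ℝ) (o : Fin M ⊕ Fin N),
        ∫⁻ y : Fin N → Fin d → ℝ, w (mergeAt y₀ y o) = ∫⁻ y, w y := by
      intro y₀ o
      rcases o with m | l
      · rfl
      · exact lintegral_add_right_eq_self w (Pi.single l y₀)
    have hwmm : ∀ (y₀ : Fin d → ℝ) (o : Fin M ⊕ Fin N),
        Measurable fun y : Fin N → Fin d → ℝ => w (mergeAt y₀ y o) := by
      intro y₀ o
      rcases o with m | l
      · exact hwm
      · exact hwm.comp (measurable_id.add_const _)
    have hm : Measurable fun y : Fin (N + 1) → Fin d → ℝ =>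
        (∏ j, (1 + ‖y j‖ₑ) ^ κ) * chainWeight M α (N + 1) y :=
      Measurable.mul (by fun_prop) (measurable_chainWeight d M α (N + 1))
    rw [volume_pi, lintegral_pi_fin_succ _ hm, lintegral_lintegral_swap]
    · calc ∫⁻ y₀ : Fin d → ℝ, ∫⁻ y : Fin N → Fin d → ℝ,
            (∏ j, (1 + ‖(Fin.cons y₀ y : Fin (N + 1) → Fin d → ℝ) j‖ₑ) ^ κ)
              * chainWeight M α (N + 1) (Fin.cons y₀ y)
          ≤ ∫⁻ y₀ : Fin d → ℝ, ∫⁻ y : Fin N → Fin d → ℝ,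
              ∑ o : Fin M ⊕ Fin N, (1 + ‖y₀‖ₑ) ^ (-(α - 2 * κ)) * w (mergeAt y₀ y o) := by
            refine lintegral_mono fun y₀ => lintegral_mono fun y => ?_
            simp only [chainWeight, Fin.prod_univ_succ, Fin.cons_zero, Fin.cons_succ, Fin.tail_cons]
            rw [Finset.mul_sum, Finset.mul_sum]
            refine Finset.sum_le_sum fun o _ => ?_
            have hexp : (1 + ‖y₀‖ₑ) ^ (-(α - 2 * κ))
                = (1 + ‖y₀‖ₑ) ^ κ * (1 + ‖y₀‖ₑ) ^ κ * (1 + ‖y₀‖ₑ) ^ (-α) := by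
              have h0 : (1 + ‖y₀‖ₑ) ≠ 0 := by simp
              have h1 : (1 + ‖y₀‖ₑ) ≠ ⊤ := by simp
              rw [← ENNReal.rpow_add _ _ h0 h1, ← ENNReal.rpow_add _ _ h0 h1]
              congr 1; ring
            calc _ ≤ (1 + ‖y₀‖ₑ) ^ κ * ((1 + ‖y₀‖ₑ) ^ κ * ∏ j, (1 + ‖mergeAt y₀ y o j‖ₑ) ^ κ)
                  * ((1 + ‖y₀‖ₑ) ^ (-α) * chainWeight M α N (mergeAt y₀ y o)) := by
                  gcongr
                  exact prod_one_add_enorm_rpow_le hκ y₀ y o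
              _ = _ := by rw [hexp, hw]; ring
        _ = ∫⁻ y₀ : Fin d → ℝ, (1 + ‖y₀‖ₑ) ^ (-(α - 2 * κ))
              * (Fintype.card (Fin M ⊕ Fin N) * ∫⁻ y, w y) := by
            refine lintegral_congr fun y₀ => ?_
            rw [lintegral_finsetSum' _ fun o _ => ((hwmm y₀ o).const_mul _).aemeasurable]
            simp_rw [lintegral_const_mul _ (hwmm y₀ _), hmerge]
            rw [Finset.sum_const, nsmul_eq_mul, Finset.card_univ]
            ring
        _ = (∫⁻ y₀ : Fin d → ℝ, (1 + ‖y₀‖ₑ) ^ (-(α - 2 * κ)))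
              * (Fintype.card (Fin M ⊕ Fin N) * ∫⁻ y, w y) :=
            lintegral_mul_const _ (by fun_prop)
        _ < ⊤ := ENNReal.mul_lt_top
            (lintegral_one_add_enorm_rpow_lt_top d (by linarith))
            (ENNReal.mul_lt_top (by simp) ih)
    · have hc : Measurable fun q : (Fin N → Fin d → ℝ) × (Fin d → ℝ) =>
          (Fin.cons q.2 q.1 : Fin (N + 1) → Fin d → ℝ) := by
        refine measurable_pi_lambda _ fun i => ?_
        refine Fin.cases ?_ (fun j => ?_) i
        · exact measurable_snd
        · exact (measurable_pi_apply j).comp measurable_fst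
      exact (hm.comp hc).aemeasurable

theorem weightBeyond_apply {ι κ : Type*} [Fintype ι] (p : ι → ℝ) (c : ι → κ → ℝ) (τ : ℝ) (i : κ) :
    weightBeyond p c τ i = weightBeyond p (fun j => c j i) τ := by
  simp only [weightBeyond, Finset.sum_apply]
  refine Finset.sum_congr rfl fun j _ => ?_
  split_ifs <;> rfl

/-- Summation by parts along an increasing enumeration of the points. -/
theorem sum_mul_eq_sum_weightBeyond {ι : Type*} [Fintype ι] (p : ι → ℝ) (c : ι → ℝ)
    (hc : ∑ j, c j = 0) {m : ℕ} {s : ℕ → ℝ} (hs : StrictMonoOn s (Set.Iic m))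
    (hp : ∀ j, ∃ n ≤ m, s n = p j) (f : ℝ → ℝ) :
    ∑ j, c j * f (p j)
      = ∑ l : Fin m, weightBeyond p c (s l) * (f (s ((l : ℕ) + 1)) - f (s (l : ℕ))) := by
  have hf : ∀ j, f (p j) = f (s 0)
      + ∑ l : Fin m, if s l < p j then f (s ((l : ℕ) + 1)) - f (s (l : ℕ)) else 0 := by
    intro j
    obtain ⟨n, hn, hnp⟩ := hp j
    rw [Fin.sum_univ_eq_sum_range
      (fun l => if s l < p j then f (s (l + 1)) - f (s l) else 0) m]
    have h1 : ∑ l ∈ Finset.range m, (if s l < p j then f (s (l + 1)) - f (s l) else 0)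
        = ∑ l ∈ Finset.range n, (f (s (l + 1)) - f (s l)) := by
      rw [← Finset.sum_filter]
      refine Finset.sum_congr ?_ fun _ _ => rfl
      ext l
      simp only [Finset.mem_filter, Finset.mem_range, ← hnp]
      constructor
      · rintro ⟨hl, h⟩
        exact (hs.lt_iff_lt (Set.mem_Iic.2 hl.le) (Set.mem_Iic.2 hn)).1 h
      · intro h
        exact ⟨h.trans_le hn, hs (Set.mem_Iic.2 (h.le.trans hn)) (Set.mem_Iic.2 hn) h⟩
    rw [h1, Finset.sum_range_sub (fun l => f (s l)), ← hnp]
    ring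
  calc ∑ j, c j * f (p j) = (∑ j, c j) * f (s 0) + ∑ j, ∑ l : Fin m,
        (if s l < p j then c j else 0) * (f (s ((l : ℕ) + 1)) - f (s (l : ℕ))) := by
        rw [Finset.sum_mul, ← Finset.sum_add_distrib]
        refine Finset.sum_congr rfl fun j _ => ?_
        rw [hf j, mul_add, Finset.mul_sum]
        congr 1
        refine Finset.sum_congr rfl fun l _ => ?_
        split_ifs <;> simp
    _ = _ := by
        rw [hc, zero_mul, zero_add, Finset.sum_comm]
        exact Finset.sum_congr rfl fun l _ => by rw [weightBeyond, Finset.sum_mul]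

theorem lintegral_weightBeyond_le {ι E : Type*} [Fintype ι] [NormedAddCommGroup E]
    (p : ι → ℝ) (c : ι → E) (hc : ∑ j, c j = 0) {m : ℕ} {s : ℕ → ℝ}
    (hs : StrictMonoOn s (Set.Iic m)) (hp : ∀ j, ∃ n ≤ m, s n = p j) {θ : ℝ} (hθ : 0 < θ) :
    ∫⁻ τ, ‖weightBeyond p c τ‖ₑ ^ θ
      ≤ ∑ l ∈ Finset.range m,
          ‖weightBeyond p c (s l)‖ₑ ^ θ * ENNReal.ofReal (s (l + 1) - s l) := by
  have hpt : ∀ τ, ‖weightBeyond p c τ‖ₑ ^ θ ≤ ∑ l ∈ Finset.range m,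
      (Set.Ico (s l) (s (l + 1))).indicator (fun _ => ‖weightBeyond p c (s l)‖ₑ ^ θ) τ := by
    intro τ
    by_cases h0 : τ < s 0
    · have : weightBeyond p c τ = 0 := by
        rw [weightBeyond, ← hc]
        refine Finset.sum_congr rfl fun j _ => if_pos ?_
        obtain ⟨n, hn, hnp⟩ := hp j
        rw [← hnp]
        exact h0.trans_le (hs.monotoneOn (by simp) (Set.mem_Iic.2 hn) (Nat.zero_le _))
      simp [this, hθ]
    by_cases hm : τ < s m
    · classical
      have hex : ∃ n, τ < s n := ⟨m, hm⟩
      obtain ⟨l, hl⟩ : ∃ l, Nat.find hex = l + 1 :=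
        Nat.exists_eq_succ_of_ne_zero fun h => h0 (h ▸ Nat.find_spec hex)
      have h1 : τ < s (l + 1) := hl ▸ Nat.find_spec hex
      have h2 : s l ≤ τ := not_lt.1 (Nat.find_min hex (by omega))
      have hlm : l < m := by
        have := Nat.find_min' hex hm
        omega
      refine le_trans (le_of_eq ?_) (Finset.single_le_sum (f := fun l =>
        (Set.Ico (s l) (s (l + 1))).indicator (fun _ => ‖weightBeyond p c (s l)‖ₑ ^ θ) τ)
        (fun _ _ => zero_le) (Finset.mem_range.2 hlm))
      rw [Set.indicator_of_mem (show τ ∈ Set.Ico (s l) (s (l + 1)) from ⟨h2, h1⟩)]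
      congr 2
      rw [weightBeyond, weightBeyond]
      refine Finset.sum_congr rfl fun j _ => ?_
      obtain ⟨n, hn, hnp⟩ := hp j
      congr 1
      refine propext ⟨fun h => h2.trans_lt h, fun h => ?_⟩
      rw [← hnp] at h ⊢
      have := (hs.lt_iff_lt (Set.mem_Iic.2 hlm.le) (Set.mem_Iic.2 hn)).1 h
      exact h1.trans_le (hs.monotoneOn (Set.mem_Iic.2 hlm) (Set.mem_Iic.2 hn) this)
    · have : weightBeyond p c τ = 0 := by
        rw [weightBeyond]
        refine Finset.sum_eq_zero fun j _ => if_neg ?_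
        obtain ⟨n, hn, hnp⟩ := hp j
        rw [← hnp]
        exact fun h => hm (h.trans_le (hs.monotoneOn (Set.mem_Iic.2 hn) (by simp) hn))
      simp [this, hθ]
  calc _ ≤ ∫⁻ τ, ∑ l ∈ Finset.range m,
        (Set.Ico (s l) (s (l + 1))).indicator (fun _ => ‖weightBeyond p c (s l)‖ₑ ^ θ) τ :=
        lintegral_mono hpt
    _ = _ := by
        rw [lintegral_finsetSum' _ fun l _ =>
          (measurable_const.indicator measurableSet_Ico).aemeasurable]
        refine Finset.sum_congr rfl fun l _ => ?_
        rw [lintegral_indicator_const measurableSet_Ico, Real.volume_Ico]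

/-- Local nondeterminism of a real process family with exponent `2 * H`. -/
def LocallyNondeterministic {Ω κ : Type*} [MeasurableSpace Ω] (P : Measure Ω)
    (Y : ℝ → Ω → κ → ℝ) (H : ℝ) : Prop :=
  ∀ T : ℝ, 0 < T → ∀ m : ℕ, 1 ≤ m → ∃ κ : ℝ, 0 < κ ∧
    ∀ s : ℕ → ℝ, s 0 = 0 → (∀ j, j < m → s j < s (j + 1)) → s m < 2 * T →
      ∀ x : Fin m → ℝ, ∀ i,
      κ * ∑ j : Fin m, (x j) ^ 2 * (s ((j : ℕ) + 1) - s (j : ℕ)) ^ (2 * H)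
        ≤ variance (fun ω => ∑ j : Fin m, x j * (Y (s ((j : ℕ) + 1)) ω i - Y (s (j : ℕ)) ω i)) P

theorem exists_enumeration {ι : Type*} [Fintype ι] {T : ℝ} (hT : 0 < T) (p : ι → ℝ)
    (hp : ∀ j, p j ∈ Set.Icc 0 T) :
    ∃ m ≤ Fintype.card ι, ∃ s : ℕ → ℝ, s 0 = 0 ∧ StrictMonoOn s (Set.Iic m) ∧ s m ≤ T ∧
      ∀ j, ∃ n ≤ m, s n = p j := by
  classical
  set F : Finset ℝ := insert 0 (Finset.univ.image p) with hF
  have hpos : 0 < F.card := Finset.card_pos.2 ⟨0, Finset.mem_insert_self _ _⟩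
  have hcard : F.card ≤ Fintype.card ι + 1 :=
    (Finset.card_insert_le _ _).trans (Nat.succ_le_succ Finset.card_image_le)
  obtain ⟨m, hm⟩ : ∃ m, F.card = m + 1 := Nat.exists_eq_succ_of_ne_zero hpos.ne'
  have hFT : ∀ q ∈ F, q ∈ Set.Icc 0 T := by
    intro q hq
    rw [hF, Finset.mem_insert, Finset.mem_image] at hq
    rcases hq with rfl | ⟨j, -, rfl⟩
    · exact ⟨le_rfl, hT.le⟩
    · exact hp j
  set e := F.orderEmbOfFin hm
  set s : ℕ → ℝ := fun n => if h : n < m + 1 then e ⟨n, h⟩ else 0 with hs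
  have hse : ∀ n (h : n < m + 1), s n = e ⟨n, h⟩ := fun n h => dif_pos h
  have hmono : StrictMonoOn s (Set.Iic m) := by
    intro a ha b hb hab
    rw [hse a (Nat.lt_succ_of_le ha), hse b (Nat.lt_succ_of_le hb)]
    exact e.strictMono hab
  have hsurj : ∀ q ∈ F, ∃ n ≤ m, s n = q := by
    intro q hq
    have : q ∈ Set.range e := by
      rw [Finset.range_orderEmbOfFin]; exact hq
    obtain ⟨n, rfl⟩ := this
    exact ⟨n, Nat.le_of_lt_succ n.2, hse n n.2⟩
  have hmem : ∀ n ≤ m, s n ∈ F := fun n hn => by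
    rw [hse n (Nat.lt_succ_of_le hn)]; exact F.orderEmbOfFin_mem hm _
  refine ⟨m, by omega, s, ?_, hmono, (hFT _ (hmem m le_rfl)).2, fun j => hsurj _ ?_⟩
  · obtain ⟨n, hn, h0⟩ := hsurj 0 (Finset.mem_insert_self _ _)
    refine le_antisymm ?_ (hFT _ (hmem 0 (Nat.zero_le _))).1
    rw [← h0]
    exact hmono.monotoneOn (by simp) (Set.mem_Iic.2 hn) (Nat.zero_le _)
  · exact Finset.mem_insert_of_mem (Finset.mem_image_of_mem _ (Finset.mem_univ _))

theorem exists_lintegral_weightBeyond_le {Ω : Type*} [MeasurableSpace Ω] {P : Measure Ω} {d : ℕ}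
    {Y : ℝ → Ω → Fin d → ℝ} {H : ℝ} (hH : 0 < H) (hY : LocallyNondeterministic P Y H)
    (ι : Type*) [Fintype ι] {T : ℝ} (hT : 0 < T) :
    ∃ C : ℝ, 0 ≤ C ∧ ∀ (p : ι → ℝ) (c : ι → Fin d → ℝ), (∀ j, p j ∈ Set.Icc 0 T) →
      ∑ j, c j = 0 →
      ∫⁻ τ, ‖weightBeyond p c τ‖ₑ ^ (1 / H) ≤ ENNReal.ofReal
        (C * (∑ i, variance (fun ω => ∑ j, c j i * Y (p j) ω i) P) ^ (1 / (2 * H))) := by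
  choose κ hκ0 hκ using hY T hT
  set A : ℕ → ℝ := fun m => if h : 1 ≤ m then m * (1 / κ m h) ^ (1 / (2 * H)) else 0 with hA
  have hA0 : ∀ m, 0 ≤ A m := fun m => by
    simp only [hA]
    split_ifs with h
    · have := hκ0 m h
      positivity
    · exact le_rfl
  refine ⟨∑ m ∈ Finset.range (Fintype.card ι + 1), A m, Finset.sum_nonneg fun m _ => hA0 m,
    fun p c hp hc => ?_⟩
  set V := ∑ i, variance (fun ω => ∑ j, c j i * Y (p j) ω i) P with hV
  have hV0 : 0 ≤ V := Finset.sum_nonneg fun i _ => variance_nonneg _ _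
  obtain ⟨m, hm, s, hs0, hs, hsm, hsp⟩ := exists_enumeration hT p hp
  have hle : A m ≤ ∑ m ∈ Finset.range (Fintype.card ι + 1), A m :=
    Finset.single_le_sum (fun m _ => hA0 m) (Finset.mem_range.2 (Nat.lt_succ_of_le hm))
  refine (lintegral_weightBeyond_le p c hc hs hsp (one_div_pos.2 hH)).trans ?_
  refine le_trans ?_ (ENNReal.ofReal_le_ofReal (mul_le_mul_of_nonneg_right hle (by positivity)))
  by_cases h1 : 1 ≤ m
  swap
  · obtain rfl : m = 0 := by omega
    simp
  have hstep : ∀ j, j < m → s j < s (j + 1) := fun j hj =>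
    hs (Set.mem_Iic.2 hj.le) (Set.mem_Iic.2 hj) (Nat.lt_succ_self j)
  have hterm : ∀ l ∈ Finset.range m,
      ‖weightBeyond p c (s l)‖ₑ ^ (1 / H) * ENNReal.ofReal (s (l + 1) - s l)
        ≤ ENNReal.ofReal ((1 / κ m h1) ^ (1 / (2 * H)) * V ^ (1 / (2 * H))) := by
    intro l hl
    have hlm := Finset.mem_range.1 hl
    have hκp := hκ0 m h1
    set Δ := s (l + 1) - s l with hΔ
    have hΔ0 : 0 < Δ := sub_pos.2 (hstep l hlm)
    have hcoord : ∀ i, κ m h1 * ((weightBeyond p c (s l) i) ^ 2 * Δ ^ (2 * H)) ≤ V := by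
      intro i
      have h2 := hκ m h1 s hs0 hstep (by linarith)
        (fun l => weightBeyond p (fun j => c j i) (s l)) i
      have h3 : (fun ω => ∑ l : Fin m, weightBeyond p (fun j => c j i) (s l)
          * (Y (s ((l : ℕ) + 1)) ω i - Y (s (l : ℕ)) ω i))
          = fun ω => ∑ j, c j i * Y (p j) ω i := by
        funext ω
        refine (sum_mul_eq_sum_weightBeyond p (fun j => c j i) ?_ hs hsp
          (fun q => Y q ω i)).symm
        simpa using congrFun hc i
      rw [h3] at h2
      have h4 : variance (fun ω => ∑ j, c j i * Y (p j) ω i) P ≤ V :=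
        Finset.single_le_sum (f := fun i => variance (fun ω => ∑ j, c j i * Y (p j) ω i) P)
          (fun i _ => variance_nonneg _ _) (Finset.mem_univ i)
      refine le_trans (mul_le_mul_of_nonneg_left ?_ hκp.le) (h2.trans h4)
      have h5 := Finset.single_le_sum (f := fun j : Fin m =>
        (weightBeyond p (fun j => c j i) (s j)) ^ 2 * (s ((j : ℕ) + 1) - s (j : ℕ)) ^ (2 * H))
        (fun j _ => mul_nonneg (sq_nonneg _)
          (Real.rpow_nonneg (sub_nonneg.2 (hstep j j.2).le) _)) (Finset.mem_univ ⟨l, hlm⟩)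
      rw [weightBeyond_apply]
      exact h5
    have hnorm : ‖weightBeyond p c (s l)‖ ≤ (1 / κ m h1 * V) ^ (1 / 2 : ℝ) * Δ ^ (-H) := by
      refine (pi_norm_le_iff_of_nonneg (by positivity)).2 fun i => ?_
      have h6 : (weightBeyond p c (s l) i) ^ 2 ≤ (1 / κ m h1 * V) * Δ ^ (-(2 * H)) := by
        rw [Real.rpow_neg hΔ0.le, ← div_eq_mul_inv, le_div_iff₀ (by positivity), one_div,
          ← div_eq_inv_mul, le_div_iff₀ hκp]
        linarith [hcoord i]
      rw [Real.norm_eq_abs]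
      refine abs_le_of_sq_le_sq ?_ (by positivity)
      refine h6.trans (le_of_eq ?_)
      rw [mul_pow, ← Real.rpow_natCast, ← Real.rpow_mul (by positivity), ← Real.rpow_natCast,
        ← Real.rpow_mul hΔ0.le]
      norm_num
      left; ring_nf
    rw [← ofReal_norm, ENNReal.ofReal_rpow_of_nonneg (norm_nonneg _) (by positivity),
      ← ENNReal.ofReal_mul (by positivity)]
    refine ENNReal.ofReal_le_ofReal ?_
    calc ‖weightBeyond p c (s l)‖ ^ (1 / H) * Δ
        ≤ ((1 / κ m h1 * V) ^ (1 / 2 : ℝ) * Δ ^ (-H)) ^ (1 / H) * Δ := by gcongr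
      _ = (1 / κ m h1 * V) ^ (1 / (2 * H)) * (Δ⁻¹ * Δ) := by
        rw [Real.mul_rpow (by positivity) (by positivity), ← Real.rpow_mul (by positivity),
          ← Real.rpow_mul hΔ0.le, show -H * (1 / H) = -1 by field_simp, Real.rpow_neg_one,
          mul_assoc]
        congr 2; field_simp
      _ = _ := by
        rw [inv_mul_cancel₀ hΔ0.ne', mul_one, Real.mul_rpow (by positivity) hV0]
  calc _ ≤ ∑ l ∈ Finset.range m,
        ENNReal.ofReal ((1 / κ m h1) ^ (1 / (2 * H)) * V ^ (1 / (2 * H))) :=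
        Finset.sum_le_sum hterm
    _ = _ := by
        simp only [hA, dif_pos h1]
        rw [Finset.sum_const, Finset.card_range, nsmul_eq_mul, ← ENNReal.ofReal_natCast,
          ← ENNReal.ofReal_mul (by positivity), mul_assoc]

theorem variance_fun_sub_le {Ω : Type*} [MeasurableSpace Ω] {P : Measure Ω} [IsFiniteMeasure P]
    {A B : Ω → ℝ} (hA : MemLp A 2 P) (hB : MemLp B 2 P) :
    variance (fun ω => A ω - B ω) P ≤ 2 * variance A P + 2 * variance B P := by
  have h1 := variance_fun_sub hA hB
  have h2 := variance_fun_add hA hB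
  have h3 := variance_nonneg (fun ω => A ω + B ω) P
  linarith

theorem exists_exp_neg_le_decay {a b : ℝ} (ha : 0 ≤ a) (hb : 0 ≤ b) (N : ℕ) :
    ∃ C : ℝ≥0∞, C ≠ ⊤ ∧ ∀ x : ℝ, 0 ≤ x →
      ENNReal.ofReal (Real.exp (-x / 8)) ≤ C * decay (ENNReal.ofReal (a * x ^ b)) ^ N := by
  set M := ⌈b⌉₊ * (2 * N) with hM
  refine ⟨ENNReal.ofReal ((1 + a) ^ (2 * N) * (8 ^ M * M.factorial * Real.exp (1 / 8))),
    ENNReal.ofReal_ne_top, fun x hx => ?_⟩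
  have hdecay : decay (ENNReal.ofReal (a * x ^ b)) ^ N
      = ENNReal.ofReal (((1 + a * x ^ b) ^ (2 * N))⁻¹) := by
    have h0 : 0 ≤ a * x ^ b := by positivity
    rw [decay, ← ENNReal.inv_pow, ← pow_mul, ← ENNReal.ofReal_one,
      ← ENNReal.ofReal_add zero_le_one h0, ← ENNReal.ofReal_pow (by positivity),
      ENNReal.ofReal_inv_of_pos (by positivity)]
  rw [hdecay, ← ENNReal.ofReal_mul (by positivity)]
  refine ENNReal.ofReal_le_ofReal ?_
  rw [← div_eq_mul_inv, le_div_iff₀ (by positivity)]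
  have h1 : 1 + a * x ^ b ≤ (1 + a) * (1 + x) ^ ⌈b⌉₊ := by
    have h2 : x ^ b ≤ (1 + x) ^ ⌈b⌉₊ := by
      calc x ^ b ≤ (1 + x) ^ b := by gcongr; linarith
        _ ≤ (1 + x) ^ ((⌈b⌉₊ : ℕ) : ℝ) :=
          Real.rpow_le_rpow_of_exponent_le (by linarith) (Nat.le_ceil b)
        _ = _ := Real.rpow_natCast _ _
    have h3 : 1 ≤ (1 + x) ^ ⌈b⌉₊ := one_le_pow₀ (by linarith)
    nlinarith
  have h4 : (1 + x) ^ M ≤ 8 ^ M * M.factorial * (Real.exp (1 / 8) * Real.exp (x / 8)) := by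
    have h5 := Real.pow_div_factorial_le_exp ((1 + x) / 8) (by positivity) M
    rw [div_pow, div_div, div_le_iff₀ (by positivity)] at h5
    rw [← Real.exp_add, ← add_div]
    linarith
  calc Real.exp (-x / 8) * (1 + a * x ^ b) ^ (2 * N)
      ≤ Real.exp (-x / 8) * ((1 + a) * (1 + x) ^ ⌈b⌉₊) ^ (2 * N) := by gcongr
    _ = Real.exp (-x / 8) * ((1 + a) ^ (2 * N) * (1 + x) ^ M) := by
        rw [mul_pow, ← pow_mul]
    _ ≤ Real.exp (-x / 8) * ((1 + a) ^ (2 * N)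
          * (8 ^ M * M.factorial * (Real.exp (1 / 8) * Real.exp (x / 8)))) := by gcongr
    _ = (1 + a) ^ (2 * N) * (8 ^ M * M.factorial * Real.exp (1 / 8))
          * (Real.exp (-x / 8) * Real.exp (x / 8)) := by ring
    _ = _ := by rw [← Real.exp_add]; ring_nf; simp

/-- The variance of a finite linear combination splits across coordinates. -/
def CoordVarianceSplit {Ω : Type*} [MeasurableSpace Ω] (P : Measure Ω) {d : ℕ}
    (Y : ℝ → Ω → Fin d → ℝ) : Prop :=
  ∀ (m : ℕ) (s : Fin m → ℝ), (∀ j, 0 ≤ s j) → ∀ y : Fin m → Fin d → ℝ,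
    variance (fun ω => ∑ j, ∑ i, y j i * Y (s j) ω i) P
      = ∑ i, variance (fun ω => ∑ j, y j i * Y (s j) ω i) P

theorem CoordVarianceSplit.fintype {Ω : Type*} [MeasurableSpace Ω] {P : Measure Ω} {d : ℕ}
    {Y : ℝ → Ω → Fin d → ℝ} (hY : CoordVarianceSplit P Y) {ι : Type*} [Fintype ι]
    (s : ι → ℝ) (hs : ∀ j, 0 ≤ s j) (y : ι → Fin d → ℝ) :
    variance (fun ω => ∑ j, ∑ i, y j i * Y (s j) ω i) P
      = ∑ i, variance (fun ω => ∑ j, y j i * Y (s j) ω i) P := by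
  set e := (Fintype.equivFin ι).symm
  have h := hY (Fintype.card ι) (s ∘ e) (fun j => hs _) (y ∘ e)
  simp only [Function.comp_apply] at h
  have h1 : ∀ f : ι → ℝ, ∑ j, f (e j) = ∑ j, f j := fun f => e.sum_comp f
  have h2 : ∀ ω, ∑ j, ∑ i, y (e j) i * Y (s (e j)) ω i = ∑ j, ∑ i, y j i * Y (s j) ω i :=
    fun ω => h1 fun j => ∑ i, y j i * Y (s j) ω i
  have h3 : ∀ i ω, ∑ j, y (e j) i * Y (s (e j)) ω i = ∑ j, y j i * Y (s j) ω i :=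
    fun i ω => h1 fun j => y j i * Y (s j) ω i
  simpa only [h2, h3] using h

/-- The integral of `exp (-V / 2)`, `V` the variance of a linear combination, over the times is
controlled by `chainWeight`. -/
theorem exists_exp_neg_variance_le {Ω : Type*} [MeasurableSpace Ω] {P : Measure Ω}
    [IsProbabilityMeasure P] {d : ℕ} {Y : ℝ → Ω → Fin d → ℝ} {H : ℝ} (hH : 0 < H)
    (hL2 : ∀ s, 0 ≤ s → ∀ i, MemLp (fun ω => Y s ω i) 2 P)
    (hsplit : CoordVarianceSplit P Y) (hY : LocallyNondeterministic P Y H)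
    (N : ℕ) [NeZero N] {T : ℝ} (hT : 0 < T) :
    ∃ C : ℝ≥0∞, C ≠ ⊤ ∧ ∀ y : Fin N → Fin d → ℝ, ∃ K : (Fin N → ℝ) → ℝ≥0∞, Measurable K ∧
      (∀ t : Fin N → ℝ, (∀ j, t j ∈ Set.Icc 0 T) → ENNReal.ofReal (Real.exp
        (-variance (fun ω => ∑ j, ∑ i, y j i * Y (t j) ω i) P / 2)) ≤ K t) ∧
      ∫⁻ t, K t ∂(Measure.pi fun _ => volume.restrict (Set.Icc 0 T))
        ≤ C * chainWeight N (1 / H) N y := by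
  obtain ⟨C₁, hC₁, h₁⟩ := exists_lintegral_weightBeyond_le hH hY (Fin N ⊕ Fin N) hT
  obtain ⟨C₂, hC₂, h₂⟩ := exists_exp_neg_le_decay hC₁ (b := 1 / (2 * H)) (by positivity) N
  obtain ⟨C₃, hC₃, h₃⟩ := exists_lintegral_chainKernel_le (E := Fin d → ℝ) N
    (θ := 1 / H) (by positivity) T N
  refine ⟨ENNReal.ofReal (Real.exp (1 / 4)) * C₂ * C₃, ENNReal.mul_ne_top (ENNReal.mul_ne_top
    ENNReal.ofReal_ne_top hC₂) hC₃, fun y => ?_⟩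
  set V : (Fin N → ℝ) → ℝ := fun t => variance (fun ω => ∑ j, ∑ i, y j i * Y (t j) ω i) P with hV
  obtain ⟨r, hr, hrV⟩ : ∃ r : Fin N → ℝ, (∀ j, r j ∈ Set.Icc 0 T) ∧
      ∀ t : Fin N → ℝ, (∀ j, t j ∈ Set.Icc 0 T) → V r ≤ V t + 1 := by
    set S := V '' {t | ∀ j, t j ∈ Set.Icc 0 T}
    have hne : S.Nonempty := ⟨_, 0, fun j => ⟨le_rfl, hT.le⟩, rfl⟩
    have hbdd : BddBelow S := ⟨0, by rintro _ ⟨t, -, rfl⟩; exact variance_nonneg _ _⟩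
    obtain ⟨_, ⟨r, hr, rfl⟩, hlt⟩ := exists_lt_of_csInf_lt hne (lt_add_one (sInf S))
    exact ⟨r, hr, fun t ht => hlt.le.trans
      (add_le_add_left (csInf_le hbdd ⟨t, ht, rfl⟩) 1)⟩
  refine ⟨fun t => ENNReal.ofReal (Real.exp (1 / 4)) * C₂ * chainKernel (1 / H) r N y t,
    (measurable_chainKernel _ _ _ _).const_mul _, fun t ht => ?_, ?_⟩
  · set p : Fin N ⊕ Fin N → ℝ := Sum.elim r t with hp
    set c : Fin N ⊕ Fin N → Fin d → ℝ := Sum.elim (-y) y with hc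
    have hpT : ∀ o, p o ∈ Set.Icc 0 T := by rintro (j | j); exacts [hr j, ht j]
    have hc0 : ∑ o, c o = 0 := by simp [hc]
    set D := ∑ i, variance (fun ω => ∑ o, c o i * Y (p o) ω i) P with hD
    have hD0 : 0 ≤ D := Finset.sum_nonneg fun i _ => variance_nonneg _ _
    have hmem : ∀ t : Fin N → ℝ, (∀ j, t j ∈ Set.Icc 0 T) →
        MemLp (fun ω => ∑ j, ∑ i, y j i * Y (t j) ω i) 2 P := fun t ht =>
      memLp_finsetSum _ fun j _ => memLp_finsetSum _ fun i _ =>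
        (hL2 (t j) (ht j).1 i).const_mul _
    have hDV : D ≤ 4 * V t + 2 := by
      have h4 : D = variance (fun ω => (∑ j, ∑ i, y j i * Y (t j) ω i)
          - ∑ j, ∑ i, y j i * Y (r j) ω i) P := by
        rw [hD, ← hsplit.fintype p (fun o => (hpT o).1) c]
        congr 1
        funext ω
        simp only [Fintype.sum_sum_type, hc, hp, Sum.elim_inl, Sum.elim_inr, Pi.neg_apply, neg_mul,
          Finset.sum_neg_distrib]
        ring
      have h5 := variance_fun_sub_le (hmem t ht) (hmem r hr)
      have h6 := hrV t ht
      rw [h4]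
      simp only [hV] at h6 ⊢
      linarith
    have hchain := decay_pow_le_chainKernel (θ := 1 / H) (by positivity) r N (-y) y t (by simp)
    calc ENNReal.ofReal (Real.exp (-V t / 2))
        ≤ ENNReal.ofReal (Real.exp (1 / 4) * Real.exp (-D / 8)) := by
          rw [← Real.exp_add]
          refine ENNReal.ofReal_le_ofReal (Real.exp_le_exp.2 ?_)
          linarith
      _ = ENNReal.ofReal (Real.exp (1 / 4)) * ENNReal.ofReal (Real.exp (-D / 8)) :=
          ENNReal.ofReal_mul (by positivity)
      _ ≤ ENNReal.ofReal (Real.exp (1 / 4))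
            * (C₂ * decay (ENNReal.ofReal (C₁ * D ^ (1 / (2 * H)))) ^ N) := by
          gcongr; exact h₂ D hD0
      _ ≤ ENNReal.ofReal (Real.exp (1 / 4)) * (C₂ * chainKernel (1 / H) r N y t) := by
          gcongr
          exact (pow_le_pow_left' (decay_anti (h₁ p c hpT hc0)) N).trans hchain
      _ = _ := by ring
  · rw [lintegral_const_mul _ (measurable_chainKernel _ _ _ _), mul_assoc _ C₃]
    gcongr
    exact h₃ r y

/-- The Fourier multiplier of the `n`-th derivative of the one-dimensional heat kernel. -/
def gaussMultiplier (ε : ℝ) (n : ℕ) (ξ : ℝ) : ℂ :=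
  (2 * Real.pi : ℂ)⁻¹ * (Complex.I * ξ) ^ n * (Real.exp (-(ε / 2) * ξ ^ 2) : ℂ)

theorem continuous_gaussMultiplier (ε : ℝ) (n : ℕ) : Continuous (gaussMultiplier ε n) := by
  unfold gaussMultiplier
  fun_prop

theorem integrable_gaussMultiplier {ε : ℝ} (hε : 0 < ε) (n : ℕ) :
    Integrable (gaussMultiplier ε n) := by
  have h := integrable_rpow_mul_exp_neg_mul_sq (half_pos hε) (s := n)
    (by have := n.cast_nonneg (α := ℝ); linarith)
  refine ((h.ofReal (𝕜 := ℂ)).const_mul ((2 * Real.pi : ℂ)⁻¹ * Complex.I ^ n)).congr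
    (Eventually.of_forall fun ξ => ?_)
  simp only [gaussMultiplier, Real.rpow_natCast, RCLike.ofReal_eq_complex_ofReal,
    Complex.ofReal_mul, Complex.ofReal_pow, mul_pow]
  ring

/-- The `n`-th derivative of the one-dimensional heat kernel. -/
def gaussDeriv (ε : ℝ) (n : ℕ) (u : ℝ) : ℂ :=
  ∫ ξ, gaussMultiplier ε n ξ * Complex.exp ((ξ * u : ℝ) * Complex.I)

theorem hasDerivAt_gaussDeriv {ε : ℝ} (hε : 0 < ε) (n : ℕ) (u : ℝ) :
    HasDerivAt (gaussDeriv ε n) (gaussDeriv ε (n + 1) u) u := by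
  have hc : ∀ n (v : ℝ), Continuous fun ξ : ℝ =>
      gaussMultiplier ε n ξ * Complex.exp ((ξ * v : ℝ) * Complex.I) := fun n v =>
    (continuous_gaussMultiplier ε n).mul (by fun_prop)
  refine (hasDerivAt_integral_of_dominated_loc_of_deriv_le (s := Set.univ) univ_mem
    (bound := fun ξ => ‖gaussMultiplier ε (n + 1) ξ‖)
    (F' := fun v ξ => gaussMultiplier ε (n + 1) ξ * Complex.exp ((ξ * v : ℝ) * Complex.I))
    (Eventually.of_forall fun v => (hc n v).aestronglyMeasurable) ?_
    (hc _ u).aestronglyMeasurable ?_ (integrable_gaussMultiplier hε _).norm ?_).2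
  · refine (integrable_gaussMultiplier hε n).mono (hc n u).aestronglyMeasurable
      (Eventually.of_forall fun ξ => ?_)
    rw [norm_mul, Complex.norm_exp_ofReal_mul_I, mul_one]
  · refine Eventually.of_forall fun ξ v _ => ?_
    rw [norm_mul, Complex.norm_exp_ofReal_mul_I, mul_one]
  · refine Eventually.of_forall fun ξ v _ => ?_
    have h1 : HasDerivAt (fun v : ℝ => ((ξ * v : ℝ) : ℂ) * Complex.I) (ξ * Complex.I) v := by
      have := ((hasDerivAt_id v).const_mul ξ).ofReal_comp.mul_const Complex.I
      simpa using this
    have h2 := (h1.cexp).const_mul (gaussMultiplier ε n ξ)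
    refine h2.congr_deriv ?_
    simp only [gaussMultiplier]
    ring

theorem gaussDeriv_zero {ε : ℝ} (hε : 0 < ε) (u : ℝ) : gaussDeriv ε 0 u
    = ((2 * Real.pi * ε) ^ (-(1 : ℝ) / 2) * Real.exp (-u ^ 2 / (2 * ε)) : ℝ) := by
  have h := fourierIntegral_gaussian (b := (ε / 2 : ℝ)) (by simpa using hε) u
  have hπ := Real.pi_pos
  have h1 : gaussDeriv ε 0 u = (2 * Real.pi : ℂ)⁻¹ * ∫ ξ : ℝ,
      Complex.exp (Complex.I * u * ξ) * Complex.exp (-((ε / 2 : ℝ) : ℂ) * ξ ^ 2) := by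
    rw [gaussDeriv, ← integral_const_mul]
    refine integral_congr_ae (Eventually.of_forall fun ξ => ?_)
    simp only [gaussMultiplier, pow_zero, mul_one]
    push_cast
    rw [show (ξ : ℂ) * u * Complex.I = Complex.I * u * ξ by ring]
    ring
  have h2 : ((Real.pi : ℂ) / ((ε / 2 : ℝ) : ℂ)) ^ (1 / 2 : ℂ)
      = ((Real.pi / (ε / 2)) ^ (1 / 2 : ℝ) : ℝ) := by
    rw [Complex.ofReal_cpow (by positivity)]
    push_cast; rfl
  have h3 : Complex.exp (-(u : ℂ) ^ 2 / (4 * ((ε / 2 : ℝ) : ℂ)))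
      = (Real.exp (-u ^ 2 / (2 * ε)) : ℝ) := by
    push_cast
    congr 2; ring
  have h4 : (2 * Real.pi)⁻¹ * (Real.pi / (ε / 2)) ^ (1 / 2 : ℝ)
      = (2 * Real.pi * ε) ^ (-(1 : ℝ) / 2) := by
    rw [← Real.sqrt_eq_rpow, neg_div, Real.rpow_neg (by positivity), ← Real.sqrt_eq_rpow,
      show Real.pi / (ε / 2) = (2 * Real.pi) ^ 2 / (2 * Real.pi * ε) by field_simp,
      Real.sqrt_div (by positivity), Real.sqrt_sq (by positivity)]
    field_simp
  rw [h1, h, h2, h3, ← h4]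
  push_cast
  ring

theorem im_gaussDeriv {ε : ℝ} (hε : 0 < ε) (n : ℕ) : ∀ u, (gaussDeriv ε n u).im = 0 := by
  induction n with
  | zero => intro u; rw [gaussDeriv_zero hε, Complex.ofReal_im]
  | succ n ih =>
    intro u
    have h := Complex.imCLM.hasFDerivAt.comp_hasDerivAt u (hasDerivAt_gaussDeriv hε n u)
    have h0 : (Complex.imCLM ∘ gaussDeriv ε n) = fun _ => 0 := funext ih
    rw [h0] at h
    exact h.unique (hasDerivAt_const u _)

theorem hasDerivAt_re_gaussDeriv {ε : ℝ} (hε : 0 < ε) (n : ℕ) (u : ℝ) :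
    HasDerivAt (fun u => (gaussDeriv ε n u).re) (gaussDeriv ε (n + 1) u).re u :=
  Complex.reCLM.hasFDerivAt.comp_hasDerivAt u (hasDerivAt_gaussDeriv hε n u)

theorem pderivCoord_prod {d : ℕ} {f : ℕ → ℝ → ℝ} (hf : ∀ n u, HasDerivAt (f n) (f (n + 1) u) u)
    (i : Fin d) (m : Fin d → ℕ) :
    pderivCoord d i (fun x => ∏ j, f (m j) (x j))
      = fun x => ∏ j, f (Function.update m i (m i + 1) j) (x j) := by
  funext x
  have h : HasFDerivAt (fun x : Fin d → ℝ => ∏ j, f (m j) (x j)) _ x :=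
    HasFDerivAt.finsetProd (u := Finset.univ) fun j _ =>
      (hf (m j) (x j)).comp_hasFDerivAt x (hasFDerivAt_apply (𝕜 := ℝ) j x)
  rw [pderivCoord, h.fderiv, sum_apply, Finset.sum_eq_single i]
  · rw [← Finset.mul_prod_erase _ _ (Finset.mem_univ i), mul_comm]
    simp only [smul_apply, ContinuousLinearMap.proj_apply, Pi.single_eq_same,
      Function.update_self, smul_eq_mul, mul_one]
    congr 1
    exact Finset.prod_congr rfl fun j hj => by
      rw [Function.update_of_ne (Finset.ne_of_mem_erase hj)]
  · intro j _ hj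
    simp [hj]
  · simp

theorem iterate_pderivCoord_prod {d : ℕ} {f : ℕ → ℝ → ℝ}
    (hf : ∀ n u, HasDerivAt (f n) (f (n + 1) u) u) (i : Fin d) (n : ℕ) (m : Fin d → ℕ) :
    (pderivCoord d i)^[n] (fun x => ∏ j, f (m j) (x j))
      = fun x => ∏ j, f (Function.update m i (m i + n) j) (x j) := by
  induction n with
  | zero => simp
  | succ n ih =>
    rw [Function.iterate_succ_apply', ih, pderivCoord_prod hf]
    simp [add_assoc]

theorem multiPDeriv_prod {d : ℕ} {f : ℕ → ℝ → ℝ}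
    (hf : ∀ n u, HasDerivAt (f n) (f (n + 1) u) u) (k : Fin d → ℕ) :
    multiPDeriv d k (fun x => ∏ j, f 0 (x j)) = fun x => ∏ j, f (k j) (x j) := by
  have key : ∀ l : List (Fin d), l.Nodup →
      l.foldr (fun i g => (pderivCoord d i)^[k i] g) (fun x => ∏ j, f 0 (x j))
        = fun x => ∏ j, f (if j ∈ l then k j else 0) (x j) := by
    intro l
    induction l with
    | nil => simp
    | cons i l ih =>
      intro hl
      rw [List.nodup_cons] at hl
      rw [List.foldr_cons, ih hl.2, iterate_pderivCoord_prod hf i _ fun j =>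
        if j ∈ l then k j else 0]
      funext x
      refine Finset.prod_congr rfl fun j _ => ?_
      congr 1
      by_cases h : j = i
      · subst h; simp [hl.1]
      · simp [h]
  rw [multiPDeriv, key _ (List.nodup_finRange d)]
  simp

/-- The Fourier multiplier of the `k`-th derivative of the heat kernel. -/
def heatMultiplier {d : ℕ} (k : Fin d → ℕ) (ε : ℝ) (ξ : Fin d → ℝ) : ℂ :=
  ∏ i, gaussMultiplier ε (k i) (ξ i)

theorem heatKernelDeriv_eq_integral {d : ℕ} (k : Fin d → ℕ) {ε : ℝ} (hε : 0 < ε) (z : Fin d → ℝ) :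
    (heatKernelDeriv d k ε z : ℂ)
      = ∫ ξ, heatMultiplier k ε ξ * Complex.exp ((∑ i, ξ i * z i : ℝ) * Complex.I) := by
  have h0 : heatKernel d ε = fun x => ∏ j, (gaussDeriv ε 0 (x j)).re := by
    funext x
    simp only [gaussDeriv_zero hε, Complex.ofReal_re]
    rw [heatKernel, Finset.prod_mul_distrib, Finset.prod_const, ← Real.exp_sum, Finset.card_univ,
      Fintype.card_fin, ← Real.rpow_natCast, ← Real.rpow_mul (by positivity), ← Finset.sum_div,
      Finset.sum_neg_distrib]
    congr 2; ring
  rw [heatKernelDeriv, h0,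
    multiPDeriv_prod (f := fun n u => (gaussDeriv ε n u).re) (hasDerivAt_re_gaussDeriv hε)]
  have h1 : ∀ n u, (((gaussDeriv ε n u).re : ℝ) : ℂ) = gaussDeriv ε n u := fun n u =>
    Complex.ext rfl (by rw [Complex.ofReal_im, im_gaussDeriv hε])
  simp only [Complex.ofReal_prod, h1]
  simp only [gaussDeriv]
  rw [← integral_fintype_prod_volume_eq_prod
    (fun i (ξ : ℝ) => gaussMultiplier ε (k i) ξ * Complex.exp ((ξ * z i : ℝ) * Complex.I))]
  refine integral_congr_ae (Eventually.of_forall fun ξ => ?_)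
  simp only [heatMultiplier, Finset.prod_mul_distrib, ← Complex.exp_sum, Complex.ofReal_sum,
    Finset.sum_mul]

theorem integrable_heatMultiplier {d : ℕ} (k : Fin d → ℕ) {ε : ℝ} (hε : 0 < ε) :
    Integrable (heatMultiplier k ε) :=
  Integrable.fintype_prod fun i => integrable_gaussMultiplier hε (k i)

theorem continuous_heatMultiplier {d : ℕ} (k : Fin d → ℕ) (ε : ℝ) :
    Continuous (heatMultiplier k ε) :=
  continuous_finsetProd _ fun i _ => (continuous_gaussMultiplier ε (k i)).comp (continuous_apply i)

theorem continuous_heatMultiplier_left {d : ℕ} (k : Fin d → ℕ) (ξ : Fin d → ℝ) :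
    Continuous fun ε => heatMultiplier k ε ξ := by
  unfold heatMultiplier gaussMultiplier
  fun_prop

theorem enorm_heatMultiplier_le {d : ℕ} (k : Fin d → ℕ) {ε : ℝ} (hε : 0 ≤ ε) (ξ : Fin d → ℝ) :
    ‖heatMultiplier k ε ξ‖ₑ ≤ (1 + ‖ξ‖ₑ) ^ (∑ i, (k i : ℝ)) := by
  have h1 : ∀ i, ‖gaussMultiplier ε (k i) (ξ i)‖ ≤ (1 + ‖ξ‖) ^ (k i) := by
    intro i
    have hpi : ‖(2 * Real.pi : ℂ)⁻¹‖ ≤ 1 := by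
      rw [norm_inv]
      refine inv_le_one_of_one_le₀ ?_
      have := Real.pi_gt_three
      rw [← Complex.ofReal_ofNat, ← Complex.ofReal_mul, Complex.norm_real,
        Real.norm_of_nonneg (by positivity)]
      linarith
    have hexp : Real.exp (-(ε / 2) * (ξ i) ^ 2) ≤ 1 := by
      rw [Real.exp_le_one_iff]
      nlinarith [sq_nonneg (ξ i)]
    rw [gaussMultiplier, norm_mul, norm_mul, norm_pow, norm_mul, Complex.norm_I, one_mul,
      Complex.norm_real, Complex.norm_real, Real.norm_of_nonneg (Real.exp_pos _).le]
    calc _ ≤ 1 * ‖ξ i‖ ^ k i * 1 := by gcongr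
      _ = ‖ξ i‖ ^ k i := by ring
      _ ≤ _ := by
        gcongr
        exact (norm_le_pi_norm ξ i).trans (by linarith)
  have h2 : ‖heatMultiplier k ε ξ‖ ≤ (1 + ‖ξ‖) ^ (∑ i, (k i : ℝ)) := by
    rw [heatMultiplier, norm_prod, ← Nat.cast_sum, Real.rpow_natCast, ← Finset.prod_pow_eq_pow_sum]
    exact Finset.prod_le_prod (fun _ _ => norm_nonneg _) fun i _ => h1 i
  calc ‖heatMultiplier k ε ξ‖ₑ = ENNReal.ofReal ‖heatMultiplier k ε ξ‖ := (ofReal_norm _).symm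
    _ ≤ ENNReal.ofReal ((1 + ‖ξ‖) ^ (∑ i, (k i : ℝ))) := ENNReal.ofReal_le_ofReal h2
    _ = _ := by
      have h3 : (0 : ℝ) < 1 + ‖ξ‖ := by positivity
      rw [← ENNReal.ofReal_rpow_of_pos h3, ENNReal.ofReal_add zero_le_one (norm_nonneg _),
        ENNReal.ofReal_one, ofReal_norm]

theorem integral_cexp_of_map_eq_gaussianReal {Ω : Type*} [MeasurableSpace Ω] {P : Measure Ω}
    {A : Ω → ℝ} (hA : Measurable A) {v : NNReal} (h : Measure.map A P = gaussianReal 0 v) :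
    ∫ ω, Complex.exp (A ω * Complex.I) ∂P = (Real.exp (-v / 2) : ℝ) := by
  have h1 := charFun_gaussianReal (μ := 0) (v := v) 1
  rw [← h, charFun_apply_real, integral_map hA.aemeasurable
    (Continuous.aestronglyMeasurable (by fun_prop))] at h1
  simp only [Complex.ofReal_one, one_mul, Complex.ofReal_zero, zero_mul, one_pow, mul_one] at h1
  rw [h1]
  push_cast
  congr 1
  ring

theorem memLp_two_of_map_eq_gaussianReal {Ω : Type*} [MeasurableSpace Ω] {P : Measure Ω}
    {A : Ω → ℝ} (hA : Measurable A) {v : NNReal} (h : Measure.map A P = gaussianReal 0 v) :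
    MemLp A 2 P := by
  have h1 := memLp_id_gaussianReal (μ := 0) (v := v) 2
  rw [← h] at h1
  exact (memLp_map_measure_iff (by fun_prop) hA.aemeasurable).1 h1

/-- If all differences `A s - B t` are square integrable with variance splitting as for
independent variables and the increment `B 1 - B 0` is not degenerate, then all `A s` and `B t` are
square integrable. -/
theorem memLp_two_of_sub {Ω : Type*} [MeasurableSpace Ω] {P : Measure Ω} [IsProbabilityMeasure P]
    {A B : ℝ → Ω → ℝ} (hA : ∀ s, Measurable (A s)) (hB : ∀ t, Measurable (B t))
    (hsub : ∀ s t, 0 ≤ s → 0 ≤ t → MemLp (fun ω => A s ω - B t ω) 2 P)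
    (hvar : ∀ s t, 0 ≤ s → 0 ≤ t →
      variance (fun ω => A s ω - B t ω) P = variance (A s) P + variance (B t) P)
    (hpos : 0 < variance (fun ω => B 1 ω - B 0 ω) P) :
    (∀ s, 0 ≤ s → MemLp (A s) 2 P) ∧ ∀ t, 0 ≤ t → MemLp (B t) 2 P := by
  have hAL : ∀ s, 0 ≤ s → MemLp (A s) 2 P := by
    intro s hs
    by_contra hnot
    have hBnot : ∀ t, 0 ≤ t → ¬ MemLp (B t) 2 P := fun t ht hBt =>
      hnot (((hsub s t hs ht).add hBt).ae_eq (Eventually.of_forall fun ω => by simp))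
    have hconst : ∀ t, 0 ≤ t → (fun ω => A s ω - B t ω)
        =ᵐ[P] fun _ => ∫ ω, (A s ω - B t ω) ∂P := by
      intro t ht
      refine ae_eq_integral_of_variance_eq_zero (hsub s t hs ht) ?_
      rw [hvar s t hs ht, variance_of_not_memLp (hA s).aestronglyMeasurable hnot,
        variance_of_not_memLp (hB t).aestronglyMeasurable (hBnot t ht), add_zero]
    refine hpos.ne' ?_
    have : (fun ω => B 1 ω - B 0 ω) =ᵐ[P] fun _ =>
        (∫ ω, (A s ω - B 0 ω) ∂P) - ∫ ω, (A s ω - B 1 ω) ∂P := by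
      filter_upwards [hconst 0 le_rfl, hconst 1 zero_le_one] with ω h0 h1
      linarith
    rw [variance_congr this]
    simp [variance, evariance]
  refine ⟨hAL, fun t ht => ?_⟩
  exact ((hAL 0 le_rfl).sub (hsub 0 t le_rfl ht)).ae_eq (Eventually.of_forall fun ω => by simp)

theorem lintegral_pi_prod {α β ι : Type*} [MeasurableSpace α] [MeasurableSpace β] [Fintype ι]
    (μ : Measure α) (ν : Measure β) [SigmaFinite μ] [SigmaFinite ν]
    {f : (ι → α × β) → ℝ≥0∞} (hf : Measurable f) :
    ∫⁻ z, f z ∂(Measure.pi fun _ => μ.prod ν) = ∫⁻ a, ∫⁻ b, f (fun j => (a j, b j))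
      ∂(Measure.pi fun _ => ν) ∂(Measure.pi fun _ => μ) := by
  have h := (measurePreserving_arrowProdEquivProdArrow α β ι (fun _ => μ) fun _ => ν).symm
  rw [← h.lintegral_comp hf]
  exact lintegral_prod (μ := Measure.pi fun _ => μ) (ν := Measure.pi fun _ => ν) _
    (hf.comp (MeasurableEquiv.measurable _)).aemeasurable

theorem enorm_integral_pow_integral_le {Ω R : Type*} [MeasurableSpace Ω] [MeasurableSpace R]
    {P : Measure Ω} [IsProbabilityMeasure P] {ρ : Measure R} [SigmaFinite ρ] {G : Ω → R → ℂ}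
    (hG : Measurable (Function.uncurry G)) {b : R → ℝ} (hb : Integrable b ρ)
    (hle : ∀ ω r, ‖G ω r‖ ≤ b r) (N : ℕ) :
    ‖∫ ω, (∫ r, G ω r ∂ρ) ^ N ∂P‖ₑ
      ≤ ∫⁻ z, ‖∫ ω, ∏ j, G ω (z j) ∂P‖ₑ ∂(Measure.pi fun _ : Fin N => ρ) := by
  have h1 : ∀ ω, (∫ r, G ω r ∂ρ) ^ N
      = ∫ z, ∏ j, G ω (z j) ∂(Measure.pi fun _ : Fin N => ρ) := fun ω => by
    rw [integral_fintype_prod_eq_prod (fun _ => G ω), Finset.prod_const, Finset.card_univ,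
      Fintype.card_fin]
  simp_rw [h1]
  rw [integral_integral_swap]
  · exact enorm_integral_le_lintegral_enorm _
  · have hbN : Integrable (fun z : Fin N → R => ∏ j, b (z j)) (Measure.pi fun _ => ρ) :=
      Integrable.fintype_prod fun _ => hb
    refine (hbN.comp_snd P).mono' ?_ (Eventually.of_forall fun q => ?_)
    · refine Measurable.aestronglyMeasurable ?_
      exact Finset.measurable_fun_prod _ fun j _ =>
        hG.comp (measurable_fst.prodMk ((measurable_pi_apply j).comp measurable_snd))
    · simp only [Function.uncurry, norm_prod]
      exact Finset.prod_le_prod (fun _ _ => norm_nonneg _) fun j _ => hle _ _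

theorem chainWeight_ne_top {E : Type*} [NormedAddCommGroup E] (M : ℕ) (θ : ℝ) (N : ℕ) :
    ∀ y : Fin N → E, chainWeight M θ N y ≠ ⊤ := by
  induction N with
  | zero => intro y; simp [chainWeight]
  | succ N ih =>
    intro y
    refine ENNReal.mul_ne_top (ENNReal.rpow_ne_top_of_ne_zero (by simp) (by simp)) ?_
    exact ENNReal.sum_ne_top.2 fun o _ => ih _

theorem lintegral_chainWeight_mul_lt_top (d M : ℕ) {θ₁ θ₂ κ : ℝ} (h₁ : 0 < θ₁) (h₂ : 0 < θ₂)
    (hκ : 0 ≤ κ) (h : 2 * κ + d < θ₁ + θ₂) (N : ℕ) :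
    ∫⁻ y : Fin N → Fin d → ℝ, (∏ j, (1 + ‖y j‖ₑ) ^ κ)
      * (chainWeight M θ₁ N y * chainWeight M θ₂ N y) < ⊤ := by
  set α := θ₁ + θ₂ with hα
  have hα0 : 0 < α := by positivity
  have hp : 1 ≤ α / θ₁ := by rw [le_div_iff₀ h₁]; linarith
  have hq : 1 ≤ α / θ₂ := by rw [le_div_iff₀ h₂]; linarith
  have hpq : (α / θ₁).HolderConjugate (α / θ₂) := by
    rw [Real.holderConjugate_iff]
    refine ⟨by rw [lt_div_iff₀ h₁]; linarith, ?_⟩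
    rw [inv_div, inv_div, ← add_div, div_self hα0.ne']
  obtain ⟨C₁, hC₁, hle₁⟩ := exists_chainWeight_rpow_le (E := Fin d → ℝ) M θ₁ hp N
  obtain ⟨C₂, hC₂, hle₂⟩ := exists_chainWeight_rpow_le (E := Fin d → ℝ) M θ₂ hq N
  rw [mul_div_cancel₀ _ h₁.ne'] at hle₁
  rw [mul_div_cancel₀ _ h₂.ne'] at hle₂
  have hdiv : ∀ (a : ℝ≥0∞) {r : ℝ}, 1 ≤ r → a / ENNReal.ofReal r ≤ a := fun a r hr =>
    ENNReal.div_le_of_le_mul (le_mul_of_one_le_right' (by simpa using hr))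
  calc _ ≤ ∫⁻ y : Fin N → Fin d → ℝ, (C₁ + C₂)
        * ((∏ j, (1 + ‖y j‖ₑ) ^ κ) * chainWeight M α N y) := by
        refine lintegral_mono fun y => ?_
        calc _ ≤ (∏ j, (1 + ‖y j‖ₑ) ^ κ) * (C₁ * chainWeight M α N y
              + C₂ * chainWeight M α N y) := by
              gcongr
              refine (ENNReal.young_inequality _ _ hpq).trans (add_le_add ?_ ?_)
              · exact (hdiv _ hp).trans (hle₁ y)
              · exact (hdiv _ hq).trans (hle₂ y)
          _ = _ := by ring
    _ < ⊤ := by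
        rw [lintegral_const_mul' _ _ (ENNReal.add_ne_top.2 ⟨hC₁, hC₂⟩)]
        exact ENNReal.mul_lt_top (ENNReal.add_ne_top.2 ⟨hC₁, hC₂⟩).lt_top
          (lintegral_chainWeight_lt_top d M hκ h N)

section Fourier

variable {d : ℕ} {Ω : Type*} {X Xt : ℝ → Ω → Fin d → ℝ}

/-- The Fourier integrand of the approximate local time for the multiplier `M`. -/
def fourierIntegrand (X Xt : ℝ → Ω → Fin d → ℝ) (x : Fin d → ℝ) (M : (Fin d → ℝ) → ℂ)
    (ω : Ω) (r : (Fin d → ℝ) × (ℝ × ℝ)) : ℂ :=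
  M r.1 * Complex.exp
    ((∑ i, r.1 i * (X r.2.1 ω i - Xt r.2.2 ω i - x i) : ℝ) * Complex.I)

/-- The reference measure on frequencies and pairs of times. -/
def freqTimeMeasure (d : ℕ) (T : ℝ) : Measure ((Fin d → ℝ) × (ℝ × ℝ)) :=
  volume.prod ((volume.restrict (Set.Icc 0 T)).prod (volume.restrict (Set.Icc 0 T)))

instance (d : ℕ) (T : ℝ) : SigmaFinite (freqTimeMeasure d T) := by
  unfold freqTimeMeasure; infer_instance

theorem norm_fourierIntegrand (x : Fin d → ℝ) (M : (Fin d → ℝ) → ℂ) (ω : Ω)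
    (r : (Fin d → ℝ) × (ℝ × ℝ)) : ‖fourierIntegrand X Xt x M ω r‖ = ‖M r.1‖ := by
  rw [fourierIntegrand, norm_mul, Complex.norm_exp_ofReal_mul_I, mul_one]

variable [MeasurableSpace Ω]

theorem measurable_fourierIntegrand (hX : Measurable fun q : ℝ × Ω => X q.1 q.2)
    (hXt : Measurable fun q : ℝ × Ω => Xt q.1 q.2) (x : Fin d → ℝ) {M : (Fin d → ℝ) → ℂ}
    (hM : Measurable M) : Measurable (Function.uncurry (fourierIntegrand X Xt x M)) := by
  have h1 : Measurable fun q : Ω × ((Fin d → ℝ) × (ℝ × ℝ)) => X q.2.2.1 q.1 :=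
    hX.comp (measurable_snd.snd.fst.prodMk measurable_fst)
  have h2 : Measurable fun q : Ω × ((Fin d → ℝ) × (ℝ × ℝ)) => Xt q.2.2.2 q.1 :=
    hXt.comp (measurable_snd.snd.snd.prodMk measurable_fst)
  refine (hM.comp measurable_snd.fst).mul (Complex.measurable_exp.comp (Measurable.mul_const ?_ _))
  refine Complex.measurable_ofReal.comp (Finset.measurable_fun_sum _ fun i _ => ?_)
  exact ((measurable_pi_apply i).comp measurable_snd.fst).mul
    ((((measurable_pi_apply i).comp h1).sub ((measurable_pi_apply i).comp h2)).sub_const _)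

theorem integrable_comp_fst_freqTimeMeasure {M : (Fin d → ℝ) → ℂ} (hM : Integrable M) (T : ℝ) :
    Integrable (fun r : (Fin d → ℝ) × (ℝ × ℝ) => M r.1) (freqTimeMeasure d T) := by
  unfold freqTimeMeasure
  exact Integrable.comp_fst hM _

theorem integrable_fourierIntegrand (hX : Measurable fun q : ℝ × Ω => X q.1 q.2)
    (hXt : Measurable fun q : ℝ × Ω => Xt q.1 q.2) (x : Fin d → ℝ) {M : (Fin d → ℝ) → ℂ}
    (hM : Measurable M) (hMi : Integrable M) (T : ℝ) (ω : Ω) :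
    Integrable (fourierIntegrand X Xt x M ω) (freqTimeMeasure d T) := by
  have hm : Measurable (fourierIntegrand X Xt x M ω) :=
    (measurable_fourierIntegrand hX hXt x hM).of_uncurry_left
  refine (integrable_comp_fst_freqTimeMeasure hMi T).mono hm.aestronglyMeasurable ?_
  exact Eventually.of_forall fun r => (norm_fourierIntegrand x M ω r).le

theorem locTimeApprox_eq_integral (hX : Measurable fun q : ℝ × Ω => X q.1 q.2)
    (hXt : Measurable fun q : ℝ × Ω => Xt q.1 q.2) (k : Fin d → ℕ) {ε : ℝ} (hε : 0 < ε)
    (T : ℝ) (x : Fin d → ℝ) (ω : Ω) :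
    (locTimeApprox d X Xt k ε T x ω : ℂ)
      = ∫ r, fourierIntegrand X Xt x (heatMultiplier k ε) ω r ∂(freqTimeMeasure d T) := by
  have hFint := integrable_fourierIntegrand hX hXt x (continuous_heatMultiplier k ε).measurable
    (integrable_heatMultiplier k hε) T ω
  have hinner : ∀ q : ℝ × ℝ, ∫ ξ, fourierIntegrand X Xt x (heatMultiplier k ε) ω (ξ, q)
      = (heatKernelDeriv d k ε (fun i => X q.1 ω i - Xt q.2 ω i - x i) : ℂ) := by
    intro q
    rw [heatKernelDeriv_eq_integral k hε]
    simp only [fourierIntegrand]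
  generalize fourierIntegrand X Xt x (heatMultiplier k ε) ω = F at hFint hinner ⊢
  unfold freqTimeMeasure at hFint ⊢
  have hFint2 := hFint.integral_prod_right
  simp only [hinner] at hFint2
  rw [integral_prod_symm _ hFint]
  simp only [hinner]
  rw [integral_prod _ hFint2]
  simp only [integral_complex_ofReal, locTimeApprox]

theorem enorm_finset_prod {ι : Type*} (u : Finset ι) (f : ι → ℂ) :
    ‖∏ j ∈ u, f j‖ₑ = ∏ j ∈ u, ‖f j‖ₑ := by
  classical
  induction u using Finset.induction_on with
  | empty => simp
  | insert a u ha ih => rw [Finset.prod_insert ha, Finset.prod_insert ha, enorm_mul, ih]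

theorem enorm_integral_prod_fourierIntegrand {P : Measure Ω}
    (hX : Measurable fun q : ℝ × Ω => X q.1 q.2)
    (hXt : Measurable fun q : ℝ × Ω => Xt q.1 q.2)
    (hGauss : ∀ (m : ℕ) (s t : Fin m → ℝ), (∀ j, 0 ≤ s j) → (∀ j, 0 ≤ t j) →
      ∀ y : Fin m → Fin d → ℝ,
      Measure.map (fun ω => ∑ j, ∑ i, y j i * (X (s j) ω i - Xt (t j) ω i)) P
        = gaussianReal 0
            (Real.toNNReal
              (variance (fun ω => ∑ j, ∑ i, y j i * (X (s j) ω i - Xt (t j) ω i)) P)))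
    (hVarSplit : ∀ (m : ℕ) (s t : Fin m → ℝ), (∀ j, 0 ≤ s j) → (∀ j, 0 ≤ t j) →
      ∀ y : Fin m → Fin d → ℝ,
      variance (fun ω => ∑ j, ∑ i, y j i * (X (s j) ω i - Xt (t j) ω i)) P
        = variance (fun ω => ∑ j, ∑ i, y j i * X (s j) ω i) P
          + variance (fun ω => ∑ j, ∑ i, y j i * Xt (t j) ω i) P)
    (x : Fin d → ℝ) (M : (Fin d → ℝ) → ℂ) {N : ℕ} (ξ : Fin N → Fin d → ℝ) {s t : Fin N → ℝ}
    (hs : ∀ j, 0 ≤ s j) (ht : ∀ j, 0 ≤ t j) :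
    ‖∫ ω, ∏ j, fourierIntegrand X Xt x M ω (ξ j, (s j, t j)) ∂P‖ₑ
      = (∏ j, ‖M (ξ j)‖ₑ)
        * (ENNReal.ofReal (Real.exp
            (-variance (fun ω => ∑ j, ∑ i, ξ j i * X (s j) ω i) P / 2))
          * ENNReal.ofReal (Real.exp
            (-variance (fun ω => ∑ j, ∑ i, ξ j i * Xt (t j) ω i) P / 2))) := by
  set A : Ω → ℝ := fun ω => ∑ j, ∑ i, ξ j i * (X (s j) ω i - Xt (t j) ω i) with hA
  have hprod : ∀ ω, ∏ j, fourierIntegrand X Xt x M ω (ξ j, (s j, t j))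
      = ((∏ j, M (ξ j)) * Complex.exp ((-∑ j, ∑ i, ξ j i * x i : ℝ) * Complex.I))
        * Complex.exp (A ω * Complex.I) := by
    intro ω
    simp only [fourierIntegrand]
    rw [Finset.prod_mul_distrib, ← Complex.exp_sum, mul_assoc, ← Complex.exp_add, ← Finset.sum_mul,
      ← add_mul, ← Complex.ofReal_sum, ← Complex.ofReal_add]
    congr 4
    rw [hA, ← Finset.sum_neg_distrib, ← Finset.sum_add_distrib]
    refine Finset.sum_congr rfl fun j _ => ?_
    rw [← Finset.sum_neg_distrib, ← Finset.sum_add_distrib]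
    exact Finset.sum_congr rfl fun i _ => by ring
  have hAm : Measurable A := by
    refine Finset.measurable_fun_sum _ fun j _ => Finset.measurable_fun_sum _ fun i _ =>
      Measurable.const_mul (Measurable.sub ?_ ?_) _
    · exact (measurable_pi_apply i).comp (hX.comp measurable_prodMk_left)
    · exact (measurable_pi_apply i).comp (hXt.comp measurable_prodMk_left)
  simp_rw [hprod]
  rw [integral_const_mul,
    integral_cexp_of_map_eq_gaussianReal hAm (hGauss N s t hs ht ξ), enorm_mul, enorm_mul,
    enorm_finset_prod, ← ofReal_norm (Complex.exp _), Complex.norm_exp_ofReal_mul_I, ENNReal.ofReal_one,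
    mul_one, Real.coe_toNNReal _ (variance_nonneg _ _), hVarSplit N s t hs ht ξ,
    ← ENNReal.ofReal_mul (Real.exp_pos _).le, ← Real.exp_add, ← ofReal_norm, Complex.norm_real,
    Real.norm_of_nonneg (Real.exp_pos _).le]
  congr 3
  ring

end Fourier

theorem ae_pi_restrict_forall_mem {ι : Type*} [Fintype ι] {α : Type*} [MeasurableSpace α]
    (μ : Measure α) [SigmaFinite μ] {s : Set α} (hs : MeasurableSet s) :
    ∀ᵐ t ∂(Measure.pi fun _ : ι => μ.restrict s), ∀ j, t j ∈ s :=
  eventually_all.2 fun j =>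
    (Measure.tendsto_eval_ae_ae (i := j)).eventually (ae_restrict_mem hs)

theorem lintegral_pi_prod_prod {α β γ ι : Type*} [MeasurableSpace α] [MeasurableSpace β]
    [MeasurableSpace γ] [Fintype ι] (μ : Measure α) (ν : Measure β) (ρ : Measure γ)
    [SigmaFinite μ] [SigmaFinite ν] [SigmaFinite ρ] {f : (ι → α × (β × γ)) → ℝ≥0∞}
    (hf : Measurable f) :
    ∫⁻ z, f z ∂(Measure.pi fun _ => μ.prod (ν.prod ρ))
      = ∫⁻ a, ∫⁻ b, ∫⁻ c, f (fun j => (a j, (b j, c j)))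
        ∂(Measure.pi fun _ => ρ) ∂(Measure.pi fun _ => ν) ∂(Measure.pi fun _ => μ) := by
  rw [lintegral_pi_prod _ _ hf]
  refine lintegral_congr fun a => lintegral_pi_prod ν ρ (hf.comp ?_)
  exact measurable_pi_lambda _ fun j => measurable_const.prodMk (measurable_pi_apply j)

theorem enorm_integral_fourierIntegrand_pow_le {d : ℕ} {Ω : Type*} [MeasurableSpace Ω]
    {P : Measure Ω} [IsProbabilityMeasure P] {X Xt : ℝ → Ω → Fin d → ℝ}
    (hX : Measurable fun q : ℝ × Ω => X q.1 q.2)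
    (hXt : Measurable fun q : ℝ × Ω => Xt q.1 q.2)
    (hGauss : ∀ (m : ℕ) (s t : Fin m → ℝ), (∀ j, 0 ≤ s j) → (∀ j, 0 ≤ t j) →
      ∀ y : Fin m → Fin d → ℝ,
      Measure.map (fun ω => ∑ j, ∑ i, y j i * (X (s j) ω i - Xt (t j) ω i)) P
        = gaussianReal 0
            (Real.toNNReal
              (variance (fun ω => ∑ j, ∑ i, y j i * (X (s j) ω i - Xt (t j) ω i)) P)))
    (hVarSplit : ∀ (m : ℕ) (s t : Fin m → ℝ), (∀ j, 0 ≤ s j) → (∀ j, 0 ≤ t j) →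
      ∀ y : Fin m → Fin d → ℝ,
      variance (fun ω => ∑ j, ∑ i, y j i * (X (s j) ω i - Xt (t j) ω i)) P
        = variance (fun ω => ∑ j, ∑ i, y j i * X (s j) ω i) P
          + variance (fun ω => ∑ j, ∑ i, y j i * Xt (t j) ω i) P)
    (T : ℝ) (x : Fin d → ℝ) {N : ℕ} {W₁ W₂ : (Fin N → Fin d → ℝ) → ℝ≥0∞}
    (h₁ : ∀ y : Fin N → Fin d → ℝ, ∃ K : (Fin N → ℝ) → ℝ≥0∞, Measurable K ∧
      (∀ t, (∀ j, t j ∈ Set.Icc 0 T) → ENNReal.ofReal (Real.exp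
        (-variance (fun ω => ∑ j, ∑ i, y j i * X (t j) ω i) P / 2)) ≤ K t) ∧
      ∫⁻ t, K t ∂(Measure.pi fun _ => volume.restrict (Set.Icc 0 T)) ≤ W₁ y)
    (h₂ : ∀ y : Fin N → Fin d → ℝ, ∃ K : (Fin N → ℝ) → ℝ≥0∞, Measurable K ∧
      (∀ t, (∀ j, t j ∈ Set.Icc 0 T) → ENNReal.ofReal (Real.exp
        (-variance (fun ω => ∑ j, ∑ i, y j i * Xt (t j) ω i) P / 2)) ≤ K t) ∧
      ∫⁻ t, K t ∂(Measure.pi fun _ => volume.restrict (Set.Icc 0 T)) ≤ W₂ y)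
    {M : (Fin d → ℝ) → ℂ} (hM : Measurable M) (hMi : Integrable M) :
    ‖∫ ω, (∫ r, fourierIntegrand X Xt x M ω r ∂(freqTimeMeasure d T)) ^ N ∂P‖ₑ
      ≤ ∫⁻ ξ : Fin N → Fin d → ℝ, (∏ j, ‖M (ξ j)‖ₑ) * (W₁ ξ * W₂ ξ) := by
  have hG := measurable_fourierIntegrand hX hXt x hM
  refine (enorm_integral_pow_integral_le hG (integrable_comp_fst_freqTimeMeasure hMi T).norm
    (fun ω r => (norm_fourierIntegrand x M ω r).le) N).trans ?_
  have hmeas : Measurable fun z : Fin N → (Fin d → ℝ) × (ℝ × ℝ) =>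
      ‖∫ ω, ∏ j, fourierIntegrand X Xt x M ω (z j) ∂P‖ₑ := by
    have : Measurable fun q : (Fin N → (Fin d → ℝ) × (ℝ × ℝ)) × Ω =>
        ∏ j, fourierIntegrand X Xt x M q.2 (q.1 j) :=
      Finset.measurable_fun_prod _ fun j _ =>
        hG.comp (measurable_snd.prodMk ((measurable_pi_apply j).comp measurable_fst))
    exact this.stronglyMeasurable.integral_prod_right.measurable.enorm
  unfold freqTimeMeasure
  rw [lintegral_pi_prod_prod _ _ _ hmeas]
  refine lintegral_mono fun ξ => ?_
  obtain ⟨K₁, hK₁m, hK₁, hK₁W⟩ := h₁ ξ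
  obtain ⟨K₂, hK₂m, hK₂, hK₂W⟩ := h₂ ξ
  calc _ ≤ ∫⁻ s, ∫⁻ t, (∏ j, ‖M (ξ j)‖ₑ) * (K₁ s * K₂ t)
        ∂(Measure.pi fun _ : Fin N => volume.restrict (Set.Icc 0 T))
        ∂(Measure.pi fun _ : Fin N => volume.restrict (Set.Icc 0 T)) := by
        refine lintegral_mono_ae ?_
        filter_upwards [ae_pi_restrict_forall_mem volume measurableSet_Icc] with s hs
        refine lintegral_mono_ae ?_
        filter_upwards [ae_pi_restrict_forall_mem volume measurableSet_Icc] with t ht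
        rw [enorm_integral_prod_fourierIntegrand hX hXt hGauss hVarSplit x M ξ
          (fun j => (hs j).1) fun j => (ht j).1]
        gcongr
        · exact hK₁ s hs
        · exact hK₂ t ht
    _ = (∏ j, ‖M (ξ j)‖ₑ) * ((∫⁻ s, K₁ s ∂(Measure.pi fun _ => volume.restrict (Set.Icc 0 T)))
          * ∫⁻ t, K₂ t ∂(Measure.pi fun _ => volume.restrict (Set.Icc 0 T))) := by
        have : ∀ s, ∫⁻ t, (∏ j, ‖M (ξ j)‖ₑ) * (K₁ s * K₂ t)
            ∂(Measure.pi fun _ : Fin N => volume.restrict (Set.Icc 0 T))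
            = (∏ j, ‖M (ξ j)‖ₑ) * (K₁ s *
              ∫⁻ t, K₂ t ∂(Measure.pi fun _ : Fin N => volume.restrict (Set.Icc 0 T))) := by
          intro s
          rw [lintegral_const_mul _ (hK₂m.const_mul _), lintegral_const_mul _ hK₂m]
        simp_rw [this]
        rw [lintegral_const_mul _ (hK₁m.mul_const _), lintegral_mul_const _ hK₁m]
    _ ≤ _ := by gcongr

/-- Square integrability of the coordinates of two processes whose differences are Gaussian. -/
theorem memLp_two_coord {d : ℕ} {Ω : Type*} [MeasurableSpace Ω]
    {P : Measure Ω} [IsProbabilityMeasure P] {X Xt : ℝ → Ω → Fin d → ℝ} {H : ℝ}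
    (hX : Measurable fun q : ℝ × Ω => X q.1 q.2)
    (hXt : Measurable fun q : ℝ × Ω => Xt q.1 q.2)
    (hGauss : ∀ (m : ℕ) (s t : Fin m → ℝ), (∀ j, 0 ≤ s j) → (∀ j, 0 ≤ t j) →
      ∀ y : Fin m → Fin d → ℝ,
      Measure.map (fun ω => ∑ j, ∑ i, y j i * (X (s j) ω i - Xt (t j) ω i)) P
        = gaussianReal 0
            (Real.toNNReal
              (variance (fun ω => ∑ j, ∑ i, y j i * (X (s j) ω i - Xt (t j) ω i)) P)))
    (hVarSplit : ∀ (m : ℕ) (s t : Fin m → ℝ), (∀ j, 0 ≤ s j) → (∀ j, 0 ≤ t j) →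
      ∀ y : Fin m → Fin d → ℝ,
      variance (fun ω => ∑ j, ∑ i, y j i * (X (s j) ω i - Xt (t j) ω i)) P
        = variance (fun ω => ∑ j, ∑ i, y j i * X (s j) ω i) P
          + variance (fun ω => ∑ j, ∑ i, y j i * Xt (t j) ω i) P)
    (hLND : LocallyNondeterministic P Xt H) (i : Fin d) :
    (∀ s, 0 ≤ s → MemLp (fun ω => X s ω i) 2 P) ∧
      ∀ t, 0 ≤ t → MemLp (fun ω => Xt t ω i) 2 P := by
  have hcoord : ∀ (Y : ℝ → Ω → Fin d → ℝ), Measurable (fun q : ℝ × Ω => Y q.1 q.2) →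
      ∀ s, Measurable fun ω => Y s ω i := fun Y hY s =>
    (measurable_pi_apply i).comp (hY.comp measurable_prodMk_left)
  have hsingle : ∀ f : Fin d → ℝ, ∑ l, (Pi.single i (1 : ℝ) : Fin d → ℝ) l * f l = f i := by
    intro f
    rw [Finset.sum_eq_single i (fun l _ hl => by simp [hl]) (by simp)]
    simp
  refine memLp_two_of_sub (A := fun s ω => X s ω i) (B := fun t ω => Xt t ω i)
    (hcoord X hX) (hcoord Xt hXt) (fun s t hs ht => ?_) (fun s t hs ht => ?_) ?_
  · have h := hGauss 1 (fun _ => s) (fun _ => t) (fun _ => hs) (fun _ => ht)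
      fun _ => Pi.single i 1
    simp only [hsingle, Finset.univ_unique, Finset.sum_const, Finset.card_singleton,
      one_smul] at h
    exact memLp_two_of_map_eq_gaussianReal ((hcoord X hX s).sub (hcoord Xt hXt t)) h
  · have h := hVarSplit 1 (fun _ => s) (fun _ => t) (fun _ => hs) (fun _ => ht)
      fun _ => Pi.single i 1
    simpa only [hsingle, Finset.univ_unique, Finset.sum_const, Finset.card_singleton,
      one_smul] using h
  · obtain ⟨κ, hκ, h⟩ := hLND 1 one_pos 1 le_rfl
    have h := h (fun j => j) (by simp) (fun j _ => by simp) (by norm_num) (fun _ => 1) i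
    simp at h
    exact hκ.trans_le h

/-- A family which is Cauchy in `L^p` along a filter has an `L^p` limit. -/
theorem exists_memLp_tendsto_eLpNorm_sub {Ω ι : Type*} [MeasurableSpace Ω] {P : Measure Ω}
    {p : ℝ≥0∞} [Fact (1 ≤ p)] {l : Filter ι} [l.NeBot] {F : ι → Ω → ℝ}
    (hF : ∀ᶠ a in l, MemLp (F a) p P)
    (hC : Tendsto (fun q : ι × ι => eLpNorm (F q.1 - F q.2) p P) (l ×ˢ l) (𝓝 0)) :
    ∃ L, MemLp L p P ∧ Tendsto (fun a => eLpNorm (F a - L) p P) l (𝓝 0) := by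
  classical
  set G : ι → Lp ℝ p P := fun a => if h : MemLp (F a) p P then h.toLp (F a) else 0 with hG
  have hGF : ∀ a (h : MemLp (F a) p P), G a = h.toLp (F a) := fun a h => dif_pos h
  have hcauchy : Cauchy (map G l) := by
    rw [cauchy_map_iff]
    refine ⟨inferInstance, tendsto_uniformity_iff_dist_tendsto_zero.2 ?_⟩
    have h0 := (ENNReal.tendsto_toReal ENNReal.zero_ne_top).comp hC
    rw [ENNReal.toReal_zero] at h0
    refine h0.congr' ?_
    filter_upwards [hF.prod_mk hF] with q hq
    rw [hGF _ hq.1, hGF _ hq.2, Lp.dist_edist, Lp.edist_toLp_toLp]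
    rfl
  obtain ⟨L, hL⟩ := cauchy_iff_exists_le_nhds.1 hcauchy
  refine ⟨L, Lp.memLp L, ?_⟩
  refine (tendsto_iff_edist_tendsto_0.1 (show Tendsto G l (𝓝 L) from hL)).congr' ?_
  filter_upwards [hF] with a ha
  rw [hGF a ha, Lp.edist_def]
  exact eLpNorm_congr_ae (ha.coeFn_toLp.sub EventuallyEq.rfl)

theorem integral_abs_rpow_eq {Ω : Type*} [MeasurableSpace Ω] {P : Measure Ω} {p : ℝ} (hp : 1 ≤ p)
    {f : Ω → ℝ} (hf : MemLp f (ENNReal.ofReal p) P) :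
    ∫ ω, |f ω| ^ p ∂P = (eLpNorm f (ENNReal.ofReal p) P).toReal ^ p := by
  have h0 : 0 < p := by linarith
  rw [hf.eLpNorm_eq_integral_rpow_norm (by simpa using h0) ENNReal.ofReal_ne_top,
    ENNReal.toReal_ofReal h0.le, ENNReal.toReal_ofReal (by positivity),
    Real.rpow_inv_rpow (by positivity) h0.ne']
  rfl

theorem lintegral_enorm_pow_of_even {Ω : Type*} [MeasurableSpace Ω] {P : Measure Ω}
    [IsFiniteMeasure P] {D : Ω → ℝ} (hD : Measurable D) {c : ℝ} (hc : ∀ ω, ‖D ω‖ ≤ c) {N : ℕ}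
    (hN : Even N) : ∫⁻ ω, ‖D ω‖ₑ ^ N ∂P = ‖∫ ω, (D ω : ℂ) ^ N ∂P‖ₑ := by
  have hFint : Integrable (fun ω => D ω ^ N) P :=
    Integrable.of_bound (hD.pow_const N).aestronglyMeasurable (c ^ N)
      (Eventually.of_forall fun ω => by rw [norm_pow]; gcongr; exact hc ω)
  simp_rw [← Complex.ofReal_pow]
  rw [integral_complex_ofReal, ← ofReal_norm, Complex.norm_real,
    Real.norm_of_nonneg (integral_nonneg fun ω => hN.pow_nonneg _),
    ofReal_integral_eq_lintegral_ofReal hFint (Eventually.of_forall fun ω => hN.pow_nonneg _)]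
  refine lintegral_congr fun ω => ?_
  rw [Real.enorm_eq_ofReal_abs, ← ENNReal.ofReal_pow (abs_nonneg _), hN.pow_abs]

theorem eLpNorm_natCast_eq {Ω : Type*} [MeasurableSpace Ω] {P : Measure Ω} (D : Ω → ℝ) {N : ℕ}
    (hN : N ≠ 0) : eLpNorm D N P = (∫⁻ ω, ‖D ω‖ₑ ^ N ∂P) ^ (1 / (N : ℝ)) := by
  rw [eLpNorm_eq_lintegral_rpow_enorm_toReal (by exact_mod_cast hN) (ENNReal.natCast_ne_top N)]
  simp

/-- The mean square type integrals controlling the Cauchy property tend to zero. -/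
theorem tendsto_lintegral_heatMultiplier_sub {d : ℕ} (k : Fin d → ℕ) {N : ℕ} [NeZero N]
    {W : (Fin N → Fin d → ℝ) → ℝ≥0∞} (hW : Measurable W) (hWtop : ∀ ξ, W ξ ≠ ⊤)
    (hfin : ∫⁻ ξ : Fin N → Fin d → ℝ, (∏ j, (1 + ‖ξ j‖ₑ) ^ (∑ i, (k i : ℝ))) * W ξ ≠ ⊤) :
    Tendsto (fun q : ℝ × ℝ => ∫⁻ ξ : Fin N → Fin d → ℝ,
      (∏ j, ‖heatMultiplier k q.1 (ξ j) - heatMultiplier k q.2 (ξ j)‖ₑ) * W ξ)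
      (𝓝[>] 0 ×ˢ 𝓝[>] 0) (𝓝 0) := by
  have hlim : ∀ ξ : Fin N → Fin d → ℝ, Tendsto (fun q : ℝ × ℝ =>
      (∏ j, ‖heatMultiplier k q.1 (ξ j) - heatMultiplier k q.2 (ξ j)‖ₑ) * W ξ)
      (𝓝[>] 0 ×ˢ 𝓝[>] 0) (𝓝 0) := by
    intro ξ
    have hcont : Continuous fun q : ℝ × ℝ =>
        ‖∏ j, (heatMultiplier k q.1 (ξ j) - heatMultiplier k q.2 (ξ j))‖ₑ :=
      (continuous_finsetProd _ fun j _ =>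
        ((continuous_heatMultiplier_left k (ξ j)).comp continuous_fst).sub
          ((continuous_heatMultiplier_left k (ξ j)).comp continuous_snd)).enorm
    have h := hcont.tendsto (0, 0)
    simp only [sub_self, Finset.prod_const, Finset.card_univ, Fintype.card_fin,
      zero_pow (NeZero.ne N), enorm_zero, enorm_finset_prod] at h
    rw [nhds_prod_eq] at h
    have h2 := ENNReal.Tendsto.mul_const (b := W ξ) h (Or.inr (hWtop ξ))
    rw [zero_mul] at h2
    exact h2.mono_left (prod_mono nhdsWithin_le_nhds nhdsWithin_le_nhds)
  rw [← lintegral_zero (μ := (volume : Measure (Fin N → Fin d → ℝ)))]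
  refine tendsto_lintegral_filter_of_dominated_convergence
    (fun ξ => 2 ^ N * ((∏ j, (1 + ‖ξ j‖ₑ) ^ (∑ i, (k i : ℝ))) * W ξ)) ?_ ?_ ?_
    (Eventually.of_forall hlim)
  · refine Eventually.of_forall fun q => (Finset.measurable_fun_prod _ fun j _ => ?_).mul hW
    have h : Measurable fun ζ => ‖heatMultiplier k q.1 ζ - heatMultiplier k q.2 ζ‖ₑ :=
      ((continuous_heatMultiplier k q.1).sub (continuous_heatMultiplier k q.2)).enorm.measurable
    exact h.comp (measurable_pi_apply j)
  · have hpos : ∀ᶠ q : ℝ × ℝ in 𝓝[>] 0 ×ˢ 𝓝[>] 0, 0 < q.1 ∧ 0 < q.2 :=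
      Filter.Eventually.prod_mk self_mem_nhdsWithin self_mem_nhdsWithin
    filter_upwards [hpos] with q hq
    refine Eventually.of_forall fun ξ => ?_
    rw [← mul_assoc]
    gcongr
    calc _ ≤ ∏ j, (2 * (1 + ‖ξ j‖ₑ) ^ (∑ i, (k i : ℝ))) := by
          refine Finset.prod_le_prod' fun j _ => ?_
          rw [two_mul]
          exact (enorm_sub_le).trans (add_le_add (enorm_heatMultiplier_le k hq.1.le _)
            (enorm_heatMultiplier_le k hq.2.le _))
      _ = _ := by rw [Finset.prod_mul_distrib]; simp
  · rw [lintegral_const_mul' _ _ (by simp)]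
    exact ENNReal.mul_ne_top (by simp) hfin

theorem measurable_locTimeApprox {d : ℕ} {Ω : Type*} [MeasurableSpace Ω]
    {X Xt : ℝ → Ω → Fin d → ℝ} (hX : Measurable fun q : ℝ × Ω => X q.1 q.2)
    (hXt : Measurable fun q : ℝ × Ω => Xt q.1 q.2) (k : Fin d → ℕ) {ε : ℝ} (hε : 0 < ε)
    (T : ℝ) (x : Fin d → ℝ) : Measurable (locTimeApprox d X Xt k ε T x) := by
  have h := (measurable_fourierIntegrand hX hXt x
    (continuous_heatMultiplier k ε).measurable).stronglyMeasurable.integral_prod_right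
    (ν := freqTimeMeasure d T)
  convert Complex.measurable_re.comp h.measurable using 1
  funext ω
  exact congrArg Complex.re (locTimeApprox_eq_integral hX hXt k hε T x ω)

theorem norm_locTimeApprox_le {d : ℕ} {Ω : Type*} [MeasurableSpace Ω]
    {X Xt : ℝ → Ω → Fin d → ℝ} (hX : Measurable fun q : ℝ × Ω => X q.1 q.2)
    (hXt : Measurable fun q : ℝ × Ω => Xt q.1 q.2) (k : Fin d → ℕ) {ε : ℝ} (hε : 0 < ε)
    (T : ℝ) (x : Fin d → ℝ) (ω : Ω) : ‖locTimeApprox d X Xt k ε T x ω‖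
      ≤ ∫ r, ‖heatMultiplier k ε r.1‖ ∂(freqTimeMeasure d T) := by
  rw [← Complex.norm_real, locTimeApprox_eq_integral hX hXt k hε T x ω]
  refine (norm_integral_le_integral_norm _).trans (le_of_eq ?_)
  exact integral_congr_ae (Eventually.of_forall fun r => norm_fourierIntegrand x _ ω r)

theorem locTimeApprox_sub_eq_integral {d : ℕ} {Ω : Type*} [MeasurableSpace Ω]
    {X Xt : ℝ → Ω → Fin d → ℝ} (hX : Measurable fun q : ℝ × Ω => X q.1 q.2)
    (hXt : Measurable fun q : ℝ × Ω => Xt q.1 q.2) (k : Fin d → ℕ) {ε η : ℝ} (hε : 0 < ε)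
    (hη : 0 < η) (T : ℝ) (x : Fin d → ℝ) (ω : Ω) :
    ((locTimeApprox d X Xt k ε T x - locTimeApprox d X Xt k η T x) ω : ℂ)
      = ∫ r, fourierIntegrand X Xt x (fun ξ => heatMultiplier k ε ξ - heatMultiplier k η ξ) ω r
        ∂(freqTimeMeasure d T) := by
  have hFint := fun {δ : ℝ} (hδ : 0 < δ) => integrable_fourierIntegrand hX hXt x
    (continuous_heatMultiplier k δ).measurable (integrable_heatMultiplier k hδ) T ω
  rw [Pi.sub_apply, Complex.ofReal_sub, locTimeApprox_eq_integral hX hXt k hε T x ω,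
    locTimeApprox_eq_integral hX hXt k hη T x ω, ← integral_sub (hFint hε) (hFint hη)]
  refine integral_congr_ae (Eventually.of_forall fun r => ?_)
  simp only [fourierIntegrand, sub_mul]

theorem stmt0
    (d : ℕ) (hd : 1 ≤ d) (H₁ H₂ : ℝ)
    (hH₁ : H₁ ∈ Set.Ioo (0 : ℝ) 1) (hH₂ : H₂ ∈ Set.Ioo (0 : ℝ) 1)
    {Ω : Type*} [MeasurableSpace Ω] (P : Measure Ω) [IsProbabilityMeasure P]
    (X Xt : ℝ → Ω → Fin d → ℝ)
    (hXmeas : Measurable fun q : ℝ × Ω => X q.1 q.2)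
    (hXtmeas : Measurable fun q : ℝ × Ω => Xt q.1 q.2)
    -- (a) Gaussianity of the linear combinations
    (hGauss : ∀ (m : ℕ) (s t : Fin m → ℝ), (∀ j, 0 ≤ s j) → (∀ j, 0 ≤ t j) →
      ∀ y : Fin m → Fin d → ℝ,
      Measure.map (fun ω => ∑ j, ∑ i, y j i * (X (s j) ω i - Xt (t j) ω i)) P
        = gaussianReal 0
            (Real.toNNReal
              (variance (fun ω => ∑ j, ∑ i, y j i * (X (s j) ω i - Xt (t j) ω i)) P)))
    -- (b) variance splitting between the two independent processes
    (hVarSplit : ∀ (m : ℕ) (s t : Fin m → ℝ), (∀ j, 0 ≤ s j) → (∀ j, 0 ≤ t j) →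
      ∀ y : Fin m → Fin d → ℝ,
      variance (fun ω => ∑ j, ∑ i, y j i * (X (s j) ω i - Xt (t j) ω i)) P
        = variance (fun ω => ∑ j, ∑ i, y j i * X (s j) ω i) P
          + variance (fun ω => ∑ j, ∑ i, y j i * Xt (t j) ω i) P)
    -- (b) variance splitting across coordinates
    (hVarCoordX : ∀ (m : ℕ) (s : Fin m → ℝ), (∀ j, 0 ≤ s j) →
      ∀ y : Fin m → Fin d → ℝ,
      variance (fun ω => ∑ j, ∑ i, y j i * X (s j) ω i) P
        = ∑ i, variance (fun ω => ∑ j, y j i * X (s j) ω i) P)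
    (hVarCoordXt : ∀ (m : ℕ) (t : Fin m → ℝ), (∀ j, 0 ≤ t j) →
      ∀ y : Fin m → Fin d → ℝ,
      variance (fun ω => ∑ j, ∑ i, y j i * Xt (t j) ω i) P
        = ∑ i, variance (fun ω => ∑ j, y j i * Xt (t j) ω i) P)
    -- (c) local nondeterminism of X with exponent 2H₁
    (hLNDX : ∀ T : ℝ, 0 < T → ∀ m : ℕ, 1 ≤ m → ∃ κ : ℝ, 0 < κ ∧
      ∀ s : ℕ → ℝ, s 0 = 0 → (∀ j, j < m → s j < s (j + 1)) → s m < 2 * T →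
        ∀ x : Fin m → ℝ, ∀ i : Fin d,
        κ * ∑ j : Fin m, (x j) ^ 2 * (s ((j : ℕ) + 1) - s (j : ℕ)) ^ (2 * H₁)
          ≤ variance
              (fun ω => ∑ j : Fin m, x j * (X (s ((j : ℕ) + 1)) ω i - X (s (j : ℕ)) ω i)) P)
    -- (c) local nondeterminism of X̃ with exponent 2H₂
    (hLNDXt : ∀ T : ℝ, 0 < T → ∀ m : ℕ, 1 ≤ m → ∃ κ : ℝ, 0 < κ ∧
      ∀ t : ℕ → ℝ, t 0 = 0 → (∀ j, j < m → t j < t (j + 1)) → t m < 2 * T →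
        ∀ x : Fin m → ℝ, ∀ i : Fin d,
        κ * ∑ j : Fin m, (x j) ^ 2 * (t ((j : ℕ) + 1) - t (j : ℕ)) ^ (2 * H₂)
          ≤ variance
              (fun ω => ∑ j : Fin m, x j * (Xt (t ((j : ℕ) + 1)) ω i - Xt (t (j : ℕ)) ω i)) P)
    (k : Fin d → ℕ)
    (hcond : H₁ * H₂ / (H₁ + H₂) * (2 * (∑ i, (k i : ℝ)) + d) < 1) :
    ∀ T : ℝ, 0 < T → ∀ x : Fin d → ℝ, ∀ p : ℝ, 1 ≤ p →
      ∃ L : Ω → ℝ,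
        Integrable (fun ω => |L ω| ^ p) P ∧
        Tendsto (fun ε : ℝ => ∫ ω, |locTimeApprox d X Xt k ε T x ω - L ω| ^ p ∂P)
          (𝓝[>] (0 : ℝ)) (𝓝 0) := by
  intro T hT x p hp
  have hp0 : 0 < p := by linarith
  have h1 := hH₁.1
  have h2 := hH₂.1
  set N : ℕ := 2 * ⌈p⌉₊ with hN
  have hNpos : 0 < ⌈p⌉₊ := Nat.ceil_pos.2 hp0
  have hNeven : Even N := even_two_mul _
  have hN0 : N ≠ 0 := by omega
  have : NeZero N := ⟨hN0⟩
  have hpN : ENNReal.ofReal p ≤ (N : ℝ≥0∞) := by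
    rw [← ENNReal.ofReal_natCast]
    refine ENNReal.ofReal_le_ofReal ((Nat.le_ceil p).trans ?_)
    exact_mod_cast (by omega : ⌈p⌉₊ ≤ N)
  have : Fact (1 ≤ ENNReal.ofReal p) := ⟨by simpa using hp⟩
  have hexp : 2 * (∑ i, (k i : ℝ)) + d < 1 / H₁ + 1 / H₂ := by
    rw [div_mul_eq_mul_div, div_lt_one (by positivity)] at hcond
    rw [div_add_div _ _ h1.ne' h2.ne', lt_div_iff₀ (by positivity)]
    linarith
  have hL2 := memLp_two_coord hXmeas hXtmeas hGauss hVarSplit (H := H₂) hLNDXt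
  obtain ⟨C₁, hC₁, hK₁⟩ := exists_exp_neg_variance_le h1 (fun s hs i => (hL2 i).1 s hs)
    hVarCoordX hLNDX N hT
  obtain ⟨C₂, hC₂, hK₂⟩ := exists_exp_neg_variance_le h2 (fun s hs i => (hL2 i).2 s hs)
    hVarCoordXt hLNDXt N hT
  set W : (Fin N → Fin d → ℝ) → ℝ≥0∞ := fun ξ =>
    C₁ * chainWeight N (1 / H₁) N ξ * (C₂ * chainWeight N (1 / H₂) N ξ) with hW
  have hWm : Measurable W := ((measurable_chainWeight d N _ N).const_mul _).mul
    ((measurable_chainWeight d N _ N).const_mul _)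
  have hWtop : ∀ ξ, W ξ ≠ ⊤ := fun ξ =>
    ENNReal.mul_ne_top (ENNReal.mul_ne_top hC₁ (chainWeight_ne_top N _ N ξ))
      (ENNReal.mul_ne_top hC₂ (chainWeight_ne_top N _ N ξ))
  have hWfin : ∫⁻ ξ : Fin N → Fin d → ℝ, (∏ j, (1 + ‖ξ j‖ₑ) ^ (∑ i, (k i : ℝ))) * W ξ ≠ ⊤ := by
    have heq : ∀ ξ : Fin N → Fin d → ℝ, (∏ j, (1 + ‖ξ j‖ₑ) ^ (∑ i, (k i : ℝ))) * W ξ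
        = C₁ * C₂ * ((∏ j, (1 + ‖ξ j‖ₑ) ^ (∑ i, (k i : ℝ)))
          * (chainWeight N (1 / H₁) N ξ * chainWeight N (1 / H₂) N ξ)) := fun ξ => by
      rw [hW]; ring
    simp_rw [heq]
    rw [lintegral_const_mul' _ _ (ENNReal.mul_ne_top hC₁ hC₂)]
    exact ENNReal.mul_ne_top (ENNReal.mul_ne_top hC₁ hC₂)
      (lintegral_chainWeight_mul_lt_top d N (by positivity) (by positivity)
        (by positivity) hexp N).ne
  set F : ℝ → Ω → ℝ := fun ε => locTimeApprox d X Xt k ε T x with hFdef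
  have hFm : ∀ {ε : ℝ}, 0 < ε → Measurable (F ε) := fun hε =>
    measurable_locTimeApprox hXmeas hXtmeas k hε T x
  have hFb : ∀ {ε : ℝ}, 0 < ε → ∀ ω, ‖F ε ω‖
      ≤ ∫ r, ‖heatMultiplier k ε r.1‖ ∂(freqTimeMeasure d T) := fun hε ω =>
    norm_locTimeApprox_le hXmeas hXtmeas k hε T x ω
  have hmoment : ∀ {ε η : ℝ}, 0 < ε → 0 < η → ∫⁻ ω, ‖(F ε - F η) ω‖ₑ ^ N ∂P
      ≤ ∫⁻ ξ : Fin N → Fin d → ℝ,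
        (∏ j, ‖heatMultiplier k ε (ξ j) - heatMultiplier k η (ξ j)‖ₑ) * W ξ := by
    intro ε η hε hη
    rw [lintegral_enorm_pow_of_even ((hFm hε).sub (hFm hη)) (fun ω =>
      (norm_sub_le _ _).trans (add_le_add (hFb hε ω) (hFb hη ω))) hNeven]
    simp_rw [hFdef, locTimeApprox_sub_eq_integral hXmeas hXtmeas k hε hη T x]
    exact enorm_integral_fourierIntegrand_pow_le hXmeas hXtmeas hGauss hVarSplit T x hK₁ hK₂
      ((continuous_heatMultiplier k ε).sub (continuous_heatMultiplier k η)).measurable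
      ((integrable_heatMultiplier k hε).sub (integrable_heatMultiplier k hη))
  have hmem : ∀ {ε : ℝ}, 0 < ε → MemLp (F ε) (ENNReal.ofReal p) P := fun hε =>
    MemLp.of_bound (hFm hε).aestronglyMeasurable _ (Eventually.of_forall (hFb hε))
  have hposE : ∀ᶠ ε : ℝ in 𝓝[>] 0, 0 < ε := self_mem_nhdsWithin
  have hcauchy : Tendsto (fun q : ℝ × ℝ => eLpNorm (F q.1 - F q.2) (ENNReal.ofReal p) P)
      (𝓝[>] 0 ×ˢ 𝓝[>] 0) (𝓝 0) := by
    have hlim := ((ENNReal.continuous_rpow_const (y := 1 / (N : ℝ))).tendsto 0).comp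
      (tendsto_lintegral_heatMultiplier_sub k hWm hWtop hWfin)
    rw [ENNReal.zero_rpow_of_pos (by positivity)] at hlim
    refine tendsto_of_tendsto_of_tendsto_of_le_of_le' tendsto_const_nhds hlim
      (Eventually.of_forall fun _ => bot_le) ?_
    filter_upwards [hposE.prod_mk hposE] with q hq
    refine (eLpNorm_le_eLpNorm_of_exponent_le hpN
      ((hFm hq.1).sub (hFm hq.2)).aestronglyMeasurable).trans ?_
    rw [eLpNorm_natCast_eq _ hN0]
    exact ENNReal.rpow_le_rpow (hmoment hq.1 hq.2) (by positivity)
  obtain ⟨L, hL, hlim⟩ := exists_memLp_tendsto_eLpNorm_sub (hposE.mono fun ε hε => hmem hε) hcauchy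
  refine ⟨L, ?_, ?_⟩
  · have h := hL.integrable_norm_rpow (by simpa using hp0) ENNReal.ofReal_ne_top
    rwa [ENNReal.toReal_ofReal hp0.le] at h
  · have h := ((ENNReal.tendsto_toReal ENNReal.zero_ne_top).comp hlim).rpow_const (p := p)
      (Or.inr hp0.le)
    rw [ENNReal.toReal_zero, Real.zero_rpow hp0.ne'] at h
    refine h.congr' ?_
    filter_upwards [hposE] with ε hε
    exact (integral_abs_rpow_eq hp ((hmem hε).sub hL)).symm

end
end

section
/- Suppose additionally that for every T>0 there are constants C_{T,H₁}, C̃_{T,H₂} > 0 with Var(X^{(i)}_t) ≤ C_{T,H₁} t^{2H₁} and Var(X̃^{(i)}_t) ≤ C̃_{T,H₂} t^{2H₂} for all t∈[0,2T] and all 1≤i≤d. If (H₁H₂/(H₁+H₂))·d ≥ 1, then for every T>0 the second moments of the approximate local time at the origin diverge: E[|L_ε^{(0)}(T,0)|²] → ∞ as ε↓0 (here k is the zero multi-index). -/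
open MeasureTheory ProbabilityTheory Filter Topology

noncomputable section

/-- The zeroth derivative of the heat kernel is the heat kernel itself. -/
lemma heatKernelDeriv_zero (d : ℕ) (ε : ℝ) :
    heatKernelDeriv d (fun _ => 0) ε = heatKernel d ε := by
  have h : ∀ (l : List (Fin d)) (f : (Fin d → ℝ) → ℝ),
      l.foldr (fun i g => (pderivCoord d i)^[0] g) f = f := by
    intro l f
    simp
  exact h _ _

lemma heatKernel_eq_prod (d : ℕ) {ε : ℝ} (hε : 0 < ε) (x : Fin d → ℝ) :
    heatKernel d ε x = ∏ i, ((√(2 * Real.pi * ε))⁻¹ * Real.exp (-(x i) ^ 2 / (2 * ε))) := by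
  have hpos : 0 < 2 * Real.pi * ε := by positivity
  rw [heatKernel, Finset.prod_mul_distrib, ← Real.exp_sum]
  congr 1
  · rw [Finset.prod_const, Finset.card_univ, Fintype.card_fin, Real.sqrt_eq_rpow,
      ← Real.rpow_neg hpos.le, ← Real.rpow_natCast, ← Real.rpow_mul hpos.le]
    congr 1
    ring
  · rw [← Finset.sum_div, Finset.sum_neg_distrib]

lemma heatKernel_nonneg (d : ℕ) {ε : ℝ} (hε : 0 < ε) (x : Fin d → ℝ) : 0 ≤ heatKernel d ε x := by
  unfold heatKernel
  positivity

lemma heatKernel_le (d : ℕ) {ε : ℝ} (hε : 0 < ε) (x : Fin d → ℝ) :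
    heatKernel d ε x ≤ (2 * Real.pi * ε) ^ (-(d : ℝ) / 2) := by
  unfold heatKernel
  refine mul_le_of_le_one_right (by positivity) (Real.exp_le_one_iff.2 ?_)
  have : 0 ≤ ∑ i, (x i) ^ 2 := Finset.sum_nonneg fun i _ => sq_nonneg _
  exact div_nonpos_of_nonpos_of_nonneg (by linarith) (by positivity)

lemma measurable_heatKernel (d : ℕ) (ε : ℝ) : Measurable (heatKernel d ε) := by
  unfold heatKernel
  fun_prop

/-- Integrating the one-dimensional heat kernel against a centered Gaussian law adds variances. -/
lemma integral_heatKernel_gaussianReal {ε : ℝ} (hε : 0 < ε) (v : NNReal) :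
    ∫ z, (√(2 * Real.pi * ε))⁻¹ * Real.exp (-z ^ 2 / (2 * ε)) ∂(gaussianReal 0 v)
      = (√(2 * Real.pi * (ε + v)))⁻¹ := by
  by_cases hv : v = 0
  · subst hv
    simp
  have hv' : (0 : ℝ) < v := by
    have := pos_iff_ne_zero.2 hv
    exact_mod_cast this
  rw [integral_gaussianReal_eq_integral_smul hv]
  have : ∀ z : ℝ, gaussianPDFReal 0 v z • ((√(2 * Real.pi * ε))⁻¹ * Real.exp (-z ^ 2 / (2 * ε)))
      = ((√(2 * Real.pi * v))⁻¹ * (√(2 * Real.pi * ε))⁻¹)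
        * Real.exp (-((v + ε) / (2 * v * ε)) * z ^ 2) := by
    intro z
    rw [gaussianPDFReal, smul_eq_mul, mul_mul_mul_comm, ← Real.exp_add]
    congr 2
    field_simp
    ring
  simp_rw [this]
  rw [integral_const_mul, integral_gaussian, ← Real.sqrt_inv, ← Real.sqrt_inv, ← Real.sqrt_inv,
    ← Real.sqrt_mul (by positivity), ← Real.sqrt_mul (by positivity)]
  congr 1
  field_simp
  ring

/-- A random vector whose linear combinations are centered Gaussian with variance
`∑ i, (y i) ^ 2 * v i` has a product Gaussian law. -/
lemma map_eq_pi_gaussianReal {ι Ω : Type*} [Fintype ι] [MeasurableSpace Ω] {P : Measure Ω}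
    [IsProbabilityMeasure P] {Z : Ω → ι → ℝ} (hZ : Measurable Z) (v : ι → NNReal)
    (h : ∀ y : ι → ℝ, P.map (fun ω => ∑ i, y i * Z ω i)
      = gaussianReal 0 (Real.toNNReal (∑ i, (y i) ^ 2 * v i))) :
    P.map Z = Measure.pi fun i => gaussianReal 0 (v i) := by
  classical
  have : IsProbabilityMeasure (P.map Z) := Measure.isProbabilityMeasure_map hZ.aemeasurable
  refine charFunDual_eq_pi_iff.1 fun L => ?_
  have hL : ∀ x : ι → ℝ, L x = ∑ i, L (Pi.single i 1) * x i := by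
    intro x
    conv_lhs => rw [pi_eq_sum_univ' x]
    simp [map_sum, mul_comm]
  have hmap : (P.map Z).map L
      = gaussianReal 0 (Real.toNNReal (∑ i, (L (Pi.single i 1)) ^ 2 * v i)) := by
    rw [Measure.map_map L.continuous.measurable hZ, ← h]
    congr 1
    funext ω
    exact hL (Z ω)
  have hsum : 0 ≤ ∑ i, (L (Pi.single i 1)) ^ 2 * (v i : ℝ) :=
    Finset.sum_nonneg fun i _ => by positivity
  have hone : ∀ i, charFunDual (gaussianReal 0 (v i)) (L.comp (.single ℝ (fun _ => ℝ) i))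
      = Complex.exp (-((v i : ℝ) * (L (Pi.single i 1)) ^ 2 / 2 : ℝ)) := by
    intro i
    have h1 : ∀ x : ℝ, L (Pi.single i x) = L (Pi.single i 1) * x := by
      intro x
      rw [hL (Pi.single i x), Finset.sum_eq_single i]
      · simp
      · intro j _ hj
        simp [hj]
      · simp
    have h2 : charFunDual (gaussianReal 0 (v i)) (L.comp (.single ℝ (fun _ => ℝ) i))
        = charFun (gaussianReal 0 (v i)) (L (Pi.single i 1)) := by
      rw [charFunDual_apply, charFun_apply_real]
      congr 1
      funext x
      have h3 : (L.comp (.single ℝ (fun _ => ℝ) i)) x = L (Pi.single i 1) * x := h1 x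
      rw [h3, Complex.ofReal_mul]
    rw [h2, charFun_gaussianReal]
    congr 1
    push_cast
    ring
  simp_rw [hone]
  rw [charFunDual_eq_charFun_map_one, hmap, charFun_gaussianReal, ← Complex.exp_sum,
    Real.coe_toNNReal _ hsum]
  congr 1
  push_cast
  simp only [mul_zero, zero_mul, one_pow, mul_one, zero_sub, Finset.sum_neg_distrib,
    Finset.sum_div]
  congr 1
  exact Finset.sum_congr rfl fun i _ => by ring

/-- Lower bound on the expected heat kernel at a Gaussian vector with independent coordinates of
variance at most `M - ε`. -/
lemma le_integral_heatKernel {d : ℕ} {Ω : Type*} [MeasurableSpace Ω] {P : Measure Ω}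
    [IsProbabilityMeasure P] {Z : Ω → Fin d → ℝ} (hZ : Measurable Z) {v : Fin d → NNReal}
    (h : P.map Z = Measure.pi fun i => gaussianReal 0 (v i)) {ε M : ℝ} (hε : 0 < ε)
    (hM : ∀ i, ε + v i ≤ M) :
    ((√(2 * Real.pi * M))⁻¹) ^ d ≤ ∫ ω, heatKernel d ε (Z ω) ∂P := by
  rw [← integral_map (f := heatKernel d ε) hZ.aemeasurable
    (measurable_heatKernel d ε).aestronglyMeasurable, h]
  simp_rw [heatKernel_eq_prod d hε]
  rw [integral_fintype_prod_eq_prod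
    (fun (_ : Fin d) z => (√(2 * Real.pi * ε))⁻¹ * Real.exp (-z ^ 2 / (2 * ε)))]
  simp_rw [integral_heatKernel_gaussianReal hε]
  calc ((√(2 * Real.pi * M))⁻¹) ^ d = ∏ _i : Fin d, (√(2 * Real.pi * M))⁻¹ := by simp
    _ ≤ _ := by
      refine Finset.prod_le_prod (fun i _ => by positivity) fun i _ => ?_
      have : 0 < ε + v i := by positivity
      have := hM i
      gcongr

/-- Fubini for a bounded jointly measurable function of two parameters and a random outcome. -/
lemma integral_integral_integral_swap_of_bounded {α β Ω : Type*} [MeasurableSpace α]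
    [MeasurableSpace β] [MeasurableSpace Ω] (μ : Measure α) (ν : Measure β) (P : Measure Ω)
    [IsFiniteMeasure μ] [IsFiniteMeasure ν] [IsFiniteMeasure P] {f : α → β → Ω → ℝ}
    (hf : Measurable fun q : (α × β) × Ω => f q.1.1 q.1.2 q.2) {B : ℝ}
    (hB : ∀ t s ω, ‖f t s ω‖ ≤ B) :
    ∫ ω, ∫ t, ∫ s, f t s ω ∂ν ∂μ ∂P = ∫ t, ∫ s, ∫ ω, f t s ω ∂P ∂ν ∂μ := by
  have hin : ∀ t ω, ‖∫ s, f t s ω ∂ν‖ ≤ B * ν.real Set.univ := fun t ω =>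
    norm_integral_le_of_norm_le_const (ae_of_all _ fun s => hB t s ω)
  rw [integral_integral_swap]
  · refine integral_congr_ae (ae_of_all _ fun t => ?_)
    refine integral_integral_swap (Integrable.of_bound (C := B) ?_ (ae_of_all _ fun q => hB _ _ _))
    exact (hf.comp (f := fun q : Ω × β => ((t, q.2), q.1)) (by fun_prop)).aestronglyMeasurable
  · refine Integrable.of_bound (C := B * ν.real Set.univ) ?_ (ae_of_all _ fun q => hin _ _)
    have : StronglyMeasurable fun q : (Ω × α) × β => f q.1.2 q.2 q.1.1 :=
      (hf.comp (f := fun q : (Ω × α) × β => ((q.1.2, q.2), q.1.1)) (by fun_prop)).stronglyMeasurable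
    exact this.integral_prod_right.aestronglyMeasurable

/-- Second moments dominate squared first moments. -/
lemma sq_integral_le_integral_sq {Ω : Type*} [MeasurableSpace Ω] {P : Measure Ω}
    [IsProbabilityMeasure P] {Y : Ω → ℝ} (hY : MemLp Y 2 P) :
    (∫ ω, Y ω ∂P) ^ 2 ≤ ∫ ω, (Y ω) ^ 2 ∂P := by
  have h := variance_nonneg Y P
  rw [variance_eq_sub hY] at h
  simpa using h

/-- A bounded measurable nonnegative function on a square which is bounded below by
`c * t ^ (-a - 1)` for `s ≤ t ^ a` and `b ≤ t` has a logarithmically large integral. -/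
lemma mul_log_le_integral_integral {g : ℝ → ℝ → ℝ} (hg : Measurable fun q : ℝ × ℝ => g q.1 q.2)
    {B : ℝ} (hB : ∀ t s, ‖g t s‖ ≤ B) (hg0 : ∀ t s, 0 ≤ g t s) {T a b c δ : ℝ} (hb : 0 < b)
    (hbδ : b ≤ δ) (hδT : δ ≤ T) (ha : 0 ≤ a) (hδa : δ ^ a ≤ T)
    (hlow : ∀ t ∈ Set.Icc b δ, ∀ s ∈ Set.Icc 0 (t ^ a), c * t ^ (-a - 1) ≤ g t s) :
    c * Real.log (δ / b) ≤ ∫ t in Set.Icc 0 T, ∫ s in Set.Icc 0 T, g t s := by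
  have hδ : 0 < δ := hb.trans_le hbδ
  have hGint : Integrable (fun t => ∫ s in Set.Icc 0 T, g t s)
      (volume.restrict (Set.Icc 0 T)) := by
    refine Integrable.of_bound (C := B * (volume.restrict (Set.Icc 0 T)).real Set.univ) ?_
      (ae_of_all _ fun t => norm_integral_le_of_norm_le_const (ae_of_all _ fun s => hB t s))
    exact hg.stronglyMeasurable.integral_prod_right.aestronglyMeasurable
  have hsub : Set.Ioc b δ ⊆ Set.Icc 0 T := fun t ht =>
    ⟨hb.le.trans ht.1.le, ht.2.trans hδT⟩
  calc c * Real.log (δ / b) = ∫ t in Set.Ioc b δ, c * t⁻¹ := by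
        rw [← intervalIntegral.integral_of_le hbδ, intervalIntegral.integral_const_mul,
          integral_inv_of_pos hb hδ]
    _ ≤ ∫ t in Set.Ioc b δ, ∫ s in Set.Icc 0 T, g t s := by
        refine setIntegral_mono_on ?_ (hGint.mono_measure (Measure.restrict_mono_set _ hsub))
          measurableSet_Ioc ?_
        · refine (intervalIntegrable_iff_integrableOn_Ioc_of_le hbδ).1 ?_
          refine (intervalIntegral.intervalIntegrable_inv (fun x hx => ?_)
            continuousOn_id).const_mul c
          rw [Set.uIcc_of_le hbδ] at hx
          exact (hb.trans_le hx.1).ne'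
        · intro t ht
          have ht0 : 0 < t := hb.trans ht.1
          have hint : Integrable (g t) (volume.restrict (Set.Icc 0 T)) :=
            Integrable.of_bound (C := B) (hg.comp measurable_prodMk_left).aestronglyMeasurable
              (ae_of_all _ fun s => hB t s)
          have hsub' : Set.Icc 0 (t ^ a) ⊆ Set.Icc 0 T :=
            Set.Icc_subset_Icc_right ((Real.rpow_le_rpow ht0.le ht.2 ha).trans hδa)
          calc c * t⁻¹ = c * t ^ (-a - 1) * volume.real (Set.Icc 0 (t ^ a)) := by
                rw [Real.volume_real_Icc_of_le (by positivity), sub_zero, mul_assoc,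
                  ← Real.rpow_add ht0, ← Real.rpow_neg_one]
                ring_nf
            _ ≤ ∫ s in Set.Icc 0 (t ^ a), g t s :=
                setIntegral_ge_of_const_le_real measurableSet_Icc (by simp)
                  (hlow t (Set.Ioc_subset_Icc_self ht))
                  (hint.mono_measure (Measure.restrict_mono_set _ hsub'))
            _ ≤ _ := setIntegral_mono_set hint (ae_of_all _ fun s => hg0 t s)
                hsub'.eventuallyLE
    _ ≤ _ := setIntegral_mono_set hGint
        (ae_of_all _ fun t => integral_nonneg fun s => hg0 t s) hsub.eventuallyLE

theorem stmt3
    (d : ℕ) (hd : 1 ≤ d) (H₁ H₂ : ℝ)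
    (hH₁ : H₁ ∈ Set.Ioo (0 : ℝ) 1) (hH₂ : H₂ ∈ Set.Ioo (0 : ℝ) 1)
    {Ω : Type*} [MeasurableSpace Ω] (P : Measure Ω) [IsProbabilityMeasure P]
    (X Xt : ℝ → Ω → Fin d → ℝ)
    (hXmeas : Measurable fun q : ℝ × Ω => X q.1 q.2)
    (hXtmeas : Measurable fun q : ℝ × Ω => Xt q.1 q.2)
    -- (a) Gaussianity of the linear combinations
    (hGauss : ∀ (m : ℕ) (s t : Fin m → ℝ), (∀ j, 0 ≤ s j) → (∀ j, 0 ≤ t j) →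
      ∀ y : Fin m → Fin d → ℝ,
      Measure.map (fun ω => ∑ j, ∑ i, y j i * (X (s j) ω i - Xt (t j) ω i)) P
        = gaussianReal 0
            (Real.toNNReal
              (variance (fun ω => ∑ j, ∑ i, y j i * (X (s j) ω i - Xt (t j) ω i)) P)))
    -- (b) variance splitting between the two independent processes
    (hVarSplit : ∀ (m : ℕ) (s t : Fin m → ℝ), (∀ j, 0 ≤ s j) → (∀ j, 0 ≤ t j) →
      ∀ y : Fin m → Fin d → ℝ,
      variance (fun ω => ∑ j, ∑ i, y j i * (X (s j) ω i - Xt (t j) ω i)) P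
        = variance (fun ω => ∑ j, ∑ i, y j i * X (s j) ω i) P
          + variance (fun ω => ∑ j, ∑ i, y j i * Xt (t j) ω i) P)
    -- (b) variance splitting across coordinates
    (hVarCoordX : ∀ (m : ℕ) (s : Fin m → ℝ), (∀ j, 0 ≤ s j) →
      ∀ y : Fin m → Fin d → ℝ,
      variance (fun ω => ∑ j, ∑ i, y j i * X (s j) ω i) P
        = ∑ i, variance (fun ω => ∑ j, y j i * X (s j) ω i) P)
    (hVarCoordXt : ∀ (m : ℕ) (t : Fin m → ℝ), (∀ j, 0 ≤ t j) →
      ∀ y : Fin m → Fin d → ℝ,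
      variance (fun ω => ∑ j, ∑ i, y j i * Xt (t j) ω i) P
        = ∑ i, variance (fun ω => ∑ j, y j i * Xt (t j) ω i) P)
    -- (c) local nondeterminism of X with exponent 2H₁
    (hLNDX : ∀ T : ℝ, 0 < T → ∀ m : ℕ, 1 ≤ m → ∃ κ : ℝ, 0 < κ ∧
      ∀ s : ℕ → ℝ, s 0 = 0 → (∀ j, j < m → s j < s (j + 1)) → s m < 2 * T →
        ∀ x : Fin m → ℝ, ∀ i : Fin d,
        κ * ∑ j : Fin m, (x j) ^ 2 * (s ((j : ℕ) + 1) - s (j : ℕ)) ^ (2 * H₁)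
          ≤ variance
              (fun ω => ∑ j : Fin m, x j * (X (s ((j : ℕ) + 1)) ω i - X (s (j : ℕ)) ω i)) P)
    -- (c) local nondeterminism of X̃ with exponent 2H₂
    (hLNDXt : ∀ T : ℝ, 0 < T → ∀ m : ℕ, 1 ≤ m → ∃ κ : ℝ, 0 < κ ∧
      ∀ t : ℕ → ℝ, t 0 = 0 → (∀ j, j < m → t j < t (j + 1)) → t m < 2 * T →
        ∀ x : Fin m → ℝ, ∀ i : Fin d,
        κ * ∑ j : Fin m, (x j) ^ 2 * (t ((j : ℕ) + 1) - t (j : ℕ)) ^ (2 * H₂)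
          ≤ variance
              (fun ω => ∑ j : Fin m, x j * (Xt (t ((j : ℕ) + 1)) ω i - Xt (t (j : ℕ)) ω i)) P)
    -- variance upper bounds: X, X̃ belong to G^d_{L,U}
    (hVarUpX : ∀ T : ℝ, 0 < T → ∃ C : ℝ, 0 < C ∧
      ∀ t ∈ Set.Icc (0 : ℝ) (2 * T), ∀ i : Fin d,
        variance (fun ω => X t ω i) P ≤ C * t ^ (2 * H₁))
    (hVarUpXt : ∀ T : ℝ, 0 < T → ∃ C : ℝ, 0 < C ∧
      ∀ t ∈ Set.Icc (0 : ℝ) (2 * T), ∀ i : Fin d,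
        variance (fun ω => Xt t ω i) P ≤ C * t ^ (2 * H₂))
    (hcond : 1 ≤ H₁ * H₂ / (H₁ + H₂) * d) :
    ∀ T : ℝ, 0 < T →
      Tendsto (fun ε : ℝ => ∫ ω, (locTimeApprox d X Xt (fun _ => 0) ε T 0 ω) ^ 2 ∂P)
        (𝓝[>] (0 : ℝ)) atTop := by
  intro T hT
  have hH1 := hH₁.1
  have hH2 := hH₂.1
  obtain ⟨C₁, hC₁, hC₁'⟩ := hVarUpX T hT
  obtain ⟨C₂, hC₂, hC₂'⟩ := hVarUpXt T hT
  have hcrit : -(H₁ / H₂) - 1 ≥ -(H₁ * d) := by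
    have h1 : H₁ + H₂ ≤ H₁ * H₂ * d := by
      rw [div_mul_eq_mul_div, le_div_iff₀ (by positivity)] at hcond
      linarith
    have h2 : (H₁ + H₂) / H₂ ≤ H₁ * d := by
      rw [div_le_iff₀ hH2]
      linarith
    rw [add_div, div_self hH2.ne'] at h2
    linarith
  -- joint measurability of the integrand
  have hmeas : Measurable fun q : (ℝ × ℝ) × Ω => fun i => X q.1.1 q.2 i - Xt q.1.2 q.2 i := by
    have h1 : Measurable fun q : (ℝ × ℝ) × Ω => X q.1.1 q.2 :=
      hXmeas.comp (f := fun q : (ℝ × ℝ) × Ω => (q.1.1, q.2)) (by fun_prop)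
    have h2 : Measurable fun q : (ℝ × ℝ) × Ω => Xt q.1.2 q.2 :=
      hXtmeas.comp (f := fun q : (ℝ × ℝ) × Ω => (q.1.2, q.2)) (by fun_prop)
    exact h1.sub h2
  -- the law of `X_t - X̃_s`
  have hlaw : ∀ t s, 0 ≤ t → 0 ≤ s → P.map (fun ω i => X t ω i - Xt s ω i)
      = Measure.pi fun i => gaussianReal 0 (Real.toNNReal
          (variance (fun ω => X t ω i) P + variance (fun ω => Xt s ω i) P)) := by
    intro t s ht hs
    refine map_eq_pi_gaussianReal
      (hmeas.comp (f := fun ω => ((t, s), ω)) measurable_prodMk_left) _ fun y => ?_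
    have hG := hGauss 1 (fun _ => t) (fun _ => s) (fun _ => ht) (fun _ => hs) (fun _ => y)
    rw [hVarSplit 1 (fun _ => t) (fun _ => s) (fun _ => ht) (fun _ => hs) (fun _ => y),
      hVarCoordX 1 (fun _ => t) (fun _ => ht) (fun _ => y),
      hVarCoordXt 1 (fun _ => s) (fun _ => hs) (fun _ => y)] at hG
    simp only [Finset.univ_unique, Finset.sum_singleton, variance_const_mul] at hG
    refine hG.trans ?_
    rw [← Finset.sum_add_distrib]
    congr 2
    refine Finset.sum_congr rfl fun i _ => ?_
    rw [Real.coe_toNNReal _ (add_nonneg (variance_nonneg _ _) (variance_nonneg _ _)), mul_add]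
  set K := 1 + C₁ + C₂ with hK
  set c := ((√(2 * Real.pi * K))⁻¹) ^ d with hc
  have hcpos : 0 < c := by positivity
  set δ := min (min T 1) (T ^ (H₂ / H₁)) with hδ
  have hδ0 : 0 < δ := by positivity
  have hδT : δ ≤ T := (min_le_left _ _).trans (min_le_left _ _)
  have hδ1 : δ ≤ 1 := (min_le_left _ _).trans (min_le_right _ _)
  have hδa : δ ^ (H₁ / H₂) ≤ T := by
    calc δ ^ (H₁ / H₂) ≤ (T ^ (H₂ / H₁)) ^ (H₁ / H₂) :=
          Real.rpow_le_rpow hδ0.le (min_le_right _ _) (by positivity)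
      _ = T := by
          rw [← Real.rpow_mul hT.le]
          have : H₂ / H₁ * (H₁ / H₂) = 1 := by field_simp
          rw [this, Real.rpow_one]
  -- lower bound for the first moment, squared
  have hbound : ∀ ε, 0 < ε → ε ^ (1 / (2 * H₁)) ≤ δ →
      (c * Real.log (δ / ε ^ (1 / (2 * H₁)))) ^ 2
        ≤ ∫ ω, (locTimeApprox d X Xt (fun _ => 0) ε T 0 ω) ^ 2 ∂P := by
    intro ε hε hεδ
    set f : ℝ → ℝ → Ω → ℝ := fun t s ω => heatKernel d ε (fun i => X t ω i - Xt s ω i) with hf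
    have hfm : Measurable fun q : (ℝ × ℝ) × Ω => f q.1.1 q.1.2 q.2 :=
      (measurable_heatKernel d ε).comp hmeas
    set B := (2 * Real.pi * ε) ^ (-(d : ℝ) / 2) with hBdef
    have hf0 : ∀ t s ω, 0 ≤ f t s ω := fun t s ω => heatKernel_nonneg d hε _
    have hfB : ∀ t s ω, ‖f t s ω‖ ≤ B := fun t s ω => by
      rw [Real.norm_of_nonneg (hf0 t s ω)]
      exact heatKernel_le d hε _
    have hL : ∀ ω, locTimeApprox d X Xt (fun _ => 0) ε T 0 ω
        = ∫ t in Set.Icc 0 T, ∫ s in Set.Icc 0 T, f t s ω := by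
      intro ω
      simp [locTimeApprox, heatKernelDeriv_zero, hf]
    simp_rw [hL]
    set μ : Measure ℝ := volume.restrict (Set.Icc 0 T) with hμ
    have hYmem : MemLp (fun ω => ∫ t, ∫ s, f t s ω ∂μ ∂μ) 2 P := by
      refine MemLp.of_bound (C := B * μ.real Set.univ * μ.real Set.univ) ?_ (ae_of_all _ fun ω =>
        norm_integral_le_of_norm_le_const (ae_of_all _ fun t =>
          norm_integral_le_of_norm_le_const (ae_of_all _ fun s => hfB t s ω)))
      have h1 : StronglyMeasurable fun q : (Ω × ℝ) × ℝ => f q.1.2 q.2 q.1.1 :=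
        (hfm.comp (f := fun q : (Ω × ℝ) × ℝ => ((q.1.2, q.2), q.1.1))
          (by fun_prop)).stronglyMeasurable
      exact (h1.integral_prod_right (ν := μ)).integral_prod_right.aestronglyMeasurable
    refine le_trans ?_ (sq_integral_le_integral_sq hYmem)
    have hlog : 0 ≤ c * Real.log (δ / ε ^ (1 / (2 * H₁))) :=
      mul_nonneg hcpos.le (Real.log_nonneg ((one_le_div (by positivity)).2 hεδ))
    refine pow_le_pow_left₀ hlog ?_ 2
    rw [integral_integral_integral_swap_of_bounded μ μ P hfm hfB]
    refine mul_log_le_integral_integral (B := B * P.real Set.univ) (a := H₁ / H₂)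
      hfm.stronglyMeasurable.integral_prod_right.measurable
      (fun t s => norm_integral_le_of_norm_le_const (ae_of_all _ fun ω => hfB t s ω))
      (fun t s => integral_nonneg fun ω => hf0 t s ω) (by positivity) hεδ hδT (by positivity)
      hδa ?_
    intro t ht s hs
    have ht0 : 0 < t := (by positivity : 0 < ε ^ (1 / (2 * H₁))).trans_le ht.1
    have hεt : ε ≤ t ^ (2 * H₁) := by
      calc ε = (ε ^ (1 / (2 * H₁))) ^ (2 * H₁) := by
            rw [← Real.rpow_mul hε.le, one_div_mul_cancel (by positivity), Real.rpow_one]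
        _ ≤ _ := Real.rpow_le_rpow (by positivity) ht.1 (by positivity)
    have hst : s ^ (2 * H₂) ≤ t ^ (2 * H₁) := by
      calc s ^ (2 * H₂) ≤ (t ^ (H₁ / H₂)) ^ (2 * H₂) :=
            Real.rpow_le_rpow hs.1 hs.2 (by positivity)
        _ = t ^ (2 * H₁) := by
            rw [← Real.rpow_mul ht0.le]
            congr 1
            field_simp
    have hsT : s ≤ T := hs.2.trans
      ((Real.rpow_le_rpow ht0.le ht.2 (by positivity)).trans hδa)
    have hlb := le_integral_heatKernel (P := P) (M := K * t ^ (2 * H₁))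
      (hmeas.comp (f := fun ω => ((t, s), ω)) measurable_prodMk_left)
      (hlaw t s ht0.le hs.1) hε (fun i => by
        rw [Real.coe_toNNReal _ (add_nonneg (variance_nonneg _ _) (variance_nonneg _ _))]
        have h1 := hC₁' t ⟨ht0.le, by linarith [ht.2]⟩ i
        have h2 := hC₂' s ⟨hs.1, by linarith⟩ i
        have h3 := mul_le_mul_of_nonneg_left hst hC₂.le
        rw [hK]
        linarith)
    refine le_trans ?_ hlb
    have hsqrt : √(2 * Real.pi * (K * t ^ (2 * H₁))) = √(2 * Real.pi * K) * t ^ H₁ := by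
      rw [← mul_assoc, Real.sqrt_mul (by positivity), mul_comm 2 H₁, Real.rpow_mul ht0.le,
        Real.rpow_two, Real.sqrt_sq (by positivity)]
    rw [hsqrt, mul_inv, mul_pow, ← hc]
    refine mul_le_mul_of_nonneg_left ?_ hcpos.le
    rw [← Real.rpow_neg ht0.le, ← Real.rpow_natCast, ← Real.rpow_mul ht0.le]
    exact Real.rpow_le_rpow_of_exponent_ge ht0 (ht.2.trans hδ1) (by linarith)
  have hrpow : Tendsto (fun ε : ℝ => ε ^ (1 / (2 * H₁))) (𝓝[>] 0) (𝓝[>] 0) := by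
    refine tendsto_nhdsWithin_iff.2 ⟨?_, ?_⟩
    · have h := (Real.continuousAt_rpow_const 0 (1 / (2 * H₁)) (Or.inr (by positivity))).tendsto
      rw [Real.zero_rpow (by positivity)] at h
      exact h.mono_left nhdsWithin_le_nhds
    · filter_upwards [self_mem_nhdsWithin] with ε hε
      exact Real.rpow_pos_of_pos hε _
  have hlim : Tendsto (fun ε : ℝ => (c * Real.log (δ / ε ^ (1 / (2 * H₁)))) ^ 2)
      (𝓝[>] 0) atTop := by
    refine (tendsto_pow_atTop two_ne_zero).comp (Tendsto.const_mul_atTop hcpos ?_)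
    refine Real.tendsto_log_atTop.comp ?_
    simp_rw [div_eq_mul_inv]
    exact (tendsto_inv_nhdsGT_zero.comp hrpow).const_mul_atTop hδ0
  refine tendsto_atTop_mono' _ ?_ hlim
  have hev : ∀ᶠ ε : ℝ in 𝓝[>] 0, ε ^ (1 / (2 * H₁)) ≤ δ :=
    hrpow.eventually (p := (· ≤ δ)) (mem_nhdsWithin_of_mem_nhds (Iic_mem_nhds hδ0))
  filter_upwards [hev, self_mem_nhdsWithin] with ε h1 h2
  exact hbound ε h2 h1

end
end
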